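/- arXiv:1208.5289 — 2 statements merged into one kernel-verified Lean document; each statement's English description precedes it below -/
import Mathlib

section
/- There exists an absolute constant c > 0 such that the following holds. Let ℓ ≥ 3 be an integer and let P be a set of n points in the plane ℝ² with at most ℓ collinear. Then the number of 3-element collinear subsets (collinear triples) of P is at most c·(n²·log ℓ + ℓ²·n). -/
open scoped Classical

/-- A finite point set has "at most ℓ collinear" if every collinear subset has ≤ ℓ points. -/
def AtMostCollinear (P : Finset (ℝ × ℝ)) (ℓ : ℕ) : Prop :=
  ∀ T ⊆ P, Collinear ℝ (T : Set (ℝ × ℝ)) → T.card ≤ ℓ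

namespace SzemerediTrotter

open Finset

/-- The slope of the segment `e`, given by its left and right endpoints. -/
noncomputable def slope (e : (ℝ × ℝ) × (ℝ × ℝ)) : ℝ := (e.2.2 - e.1.2) / (e.2.1 - e.1.1)

/-- The second coordinate at abscissa `x` of the line spanned by the segment `e`. -/
noncomputable def height (e : (ℝ × ℝ) × (ℝ × ℝ)) (x : ℝ) : ℝ := e.1.2 + slope e * (x - e.1.1)

theorem height_left (e : (ℝ × ℝ) × (ℝ × ℝ)) : height e e.1.1 = e.1.2 := by simp [height]

theorem height_right {e : (ℝ × ℝ) × (ℝ × ℝ)} (he : e.1.1 < e.2.1) :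
    height e e.2.1 = e.2.2 := by
  have : e.2.1 - e.1.1 ≠ 0 := by linarith
  simp only [height, slope]
  field_simp
  ring

theorem height_eq_right {e : (ℝ × ℝ) × (ℝ × ℝ)} (he : e.1.1 < e.2.1) (x : ℝ) :
    height e x = e.2.2 + slope e * (x - e.2.1) := by
  rw [← height_right he]
  simp only [height]
  ring

/-- The interiors of the segments `e` and `f` share a point. -/
def Cross (e f : (ℝ × ℝ) × (ℝ × ℝ)) : Prop :=
  ∃ x, e.1.1 < x ∧ x < e.2.1 ∧ f.1.1 < x ∧ x < f.2.1 ∧ height e x = height f x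

theorem exists_affine_eq_zero {a b x y : ℝ} (hx : a + b * x < 0) (hy : 0 < a + b * y) :
    ∃ z, a + b * z = 0 ∧ min x y < z ∧ z < max x y := by
  have hb : b ≠ 0 := by
    rintro rfl
    linarith
  refine ⟨-a / b, by field_simp; ring, ?_⟩
  rcases lt_or_gt_of_ne hb with hb | hb
  · have h1 : y < -a / b := by rw [lt_div_iff_of_neg hb]; linarith
    have h2 : -a / b < x := by rw [div_lt_iff_of_neg hb]; linarith
    exact ⟨min_lt_of_right_lt h1, lt_max_of_lt_left h2⟩
  · have h1 : x < -a / b := by rw [lt_div_iff₀ hb]; linarith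
    have h2 : -a / b < y := by rw [div_lt_iff₀ hb]; linarith
    exact ⟨min_lt_of_left_lt h1, lt_max_of_lt_right h2⟩

theorem height_le_of_not_cross {e f : (ℝ × ℝ) × (ℝ × ℝ)} (h : ¬ Cross e f) {x y : ℝ}
    (hex : e.1.1 ≤ x) (hxe : x ≤ e.2.1) (hfx : f.1.1 ≤ x) (hxf : x ≤ f.2.1)
    (hey : e.1.1 ≤ y) (hye : y ≤ e.2.1) (hfy : f.1.1 ≤ y) (hyf : y ≤ f.2.1)
    (hlt : height e x < height f x) : height e y ≤ height f y := by
  by_contra! hgt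
  obtain ⟨z, hz, hz1, hz2⟩ := exists_affine_eq_zero
    (a := e.1.2 - slope e * e.1.1 - (f.1.2 - slope f * f.1.1)) (b := slope e - slope f)
    (x := x) (y := y) (by simp only [height] at hlt; linarith)
    (by simp only [height] at hgt; linarith)
  refine h ⟨z, (le_min hex hey).trans_lt hz1, hz2.trans_le (max_le hxe hye),
    (le_min hfx hfy).trans_lt hz1, hz2.trans_le (max_le hxf hyf), ?_⟩
  simp only [height]
  linarith

/-- The segment `e` is the first one of `E` met when going down from `v`. -/
def DirectlyBelow (E : Finset ((ℝ × ℝ) × (ℝ × ℝ))) (e : (ℝ × ℝ) × (ℝ × ℝ)) (v : ℝ × ℝ) : Prop :=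
  e.1.1 < v.1 ∧ v.1 < e.2.1 ∧ height e v.1 < v.2 ∧
    ∀ f ∈ E, f.1.1 < v.1 → v.1 < f.2.1 → height f v.1 < v.2 → height f v.1 ≤ height e v.1

/-- In a plane straight-line graph, a segment that is neither the topmost one to the right of its
left endpoint nor the topmost one to the left of its right endpoint lies directly below a vertex. -/
theorem exists_directlyBelow {V : Finset (ℝ × ℝ)} (hV : Set.InjOn Prod.fst (V : Set (ℝ × ℝ)))
    {E : Finset ((ℝ × ℝ) × (ℝ × ℝ))} (hE : ∀ e ∈ E, e.1 ∈ V ∧ e.2 ∈ V ∧ e.1.1 < e.2.1)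
    (hvert : ∀ e ∈ E, ∀ v ∈ V, e.1.1 < v.1 → v.1 < e.2.1 → v.2 ≠ height e v.1)
    (hcross : ∀ e ∈ E, ∀ f ∈ E, e ≠ f → ¬ Cross e f)
    {e : (ℝ × ℝ) × (ℝ × ℝ)} (he : e ∈ E)
    (hl : ∃ f ∈ E, f.1 = e.1 ∧ slope e < slope f)
    (hr : ∃ g ∈ E, g.2 = e.2 ∧ slope g < slope e) :
    ∃ v ∈ V, DirectlyBelow E e v := by
  obtain ⟨heV1, heV2, helt⟩ := hE e he
  obtain ⟨f, hf, hfmin⟩ := (E.filter fun f => f.1 = e.1 ∧ slope e < slope f).exists_min_image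
    slope (by
      obtain ⟨f, hf, h⟩ := hl
      exact ⟨f, by simp [hf, h]⟩)
  simp only [mem_filter] at hf hfmin
  obtain ⟨hfE, hfe, hfs⟩ := hf
  obtain ⟨g, hgE, hge, hgs⟩ := hr
  obtain ⟨hfV1, hfV2, hflt⟩ := hE f hfE
  obtain ⟨hgV1, hgV2, hglt⟩ := hE g hgE
  have hef (x : ℝ) (hx : e.1.1 < x) : height e x < height f x := by
    simp only [height, hfe]
    have := mul_lt_mul_of_pos_right hfs (sub_pos.2 hx)
    linarith
  have heg (x : ℝ) (hx : x < e.2.1) : height e x < height g x := by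
    rw [height_eq_right helt, height_eq_right hglt, hge]
    have := mul_lt_mul_of_neg_right hgs (sub_neg.2 hx)
    linarith
  have hfp : height f e.1.1 = e.1.2 := by rw [← hfe, height_left]
  have hgq : height g e.2.1 = e.2.2 := by rw [← hge, height_right hglt]
  set W := V.filter fun v =>
    e.1.1 < v.1 ∧ v.1 < e.2.1 ∧ v.1 ≤ f.2.1 ∧ height e v.1 < v.2 ∧ v.2 ≤ height f v.1 with hW
  have hWne : W.Nonempty := by
    rcases lt_trichotomy f.2.1 e.2.1 with h | h | h
    · refine ⟨f.2, ?_⟩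
      have h1 : e.1.1 < f.2.1 := by rw [← hfe]; exact hflt
      have := hef _ h1
      rw [height_right hflt] at this
      simp [hW, hfV2, h1, h, this, height_right hflt]
    · have : f.2 = e.2 := hV hfV2 heV2 h
      have : f = e := Prod.ext hfe this
      rw [this] at hfs
      exact absurd hfs (lt_irrefl _)
    · have hfg : ¬ Cross f g := hcross f hfE g hgE (by rintro rfl; linarith)
      have hgf : ¬ Cross g f := hcross g hgE f hfE (by rintro rfl; linarith)
      have hq : height g e.2.1 < height f e.2.1 := by
        rw [hgq, ← height_right helt]
        exact hef _ helt
      have hge1 : g.2.1 = e.2.1 := by rw [hge]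
      have hfe1 : f.1.1 = e.1.1 := by rw [hfe]
      rcases lt_trichotomy g.1.1 e.1.1 with h' | h' | h'
      · have h1 := height_le_of_not_cross hgf (x := e.2.1) (y := e.1.1) (by linarith) (by linarith)
          (by linarith) (by linarith) (by linarith) (by linarith) (by linarith) (by linarith) hq
        have h2 := heg e.1.1 helt
        rw [height_left] at h2
        linarith
      · have : g = e := Prod.ext (hV hgV1 heV1 h') hge
        rw [this] at hgs
        exact absurd hgs (lt_irrefl _)
      · have h1 := height_le_of_not_cross hgf (x := e.2.1) (y := g.1.1) (by linarith) (by linarith)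
          (by linarith) (by linarith) (by linarith) (by linarith) (by linarith) (by linarith) hq
        rw [height_left] at h1
        have h2 := heg g.1.1 (by linarith)
        rw [height_left] at h2
        refine ⟨g.1, ?_⟩
        simp only [hW, mem_filter]
        exact ⟨hgV1, h', by linarith, by linarith, h2, h1⟩
  obtain ⟨w, hw, hwmin⟩ := W.exists_min_image Prod.fst hWne
  simp only [hW, mem_filter] at hw hwmin
  obtain ⟨hwV, hpw, hwq, hwr, hew, hwf⟩ := hw
  refine ⟨w, hwV, hpw, hwq, hew, fun g' hg' hsw hwt hgw => ?_⟩
  by_contra! hlt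
  obtain ⟨hg'V1, hg'V2, hg'lt⟩ := hE g' hg'
  have hfe1 : f.1.1 = e.1.1 := by rw [hfe]
  have heg' : ¬ Cross e g' := hcross e he g' hg' (by rintro rfl; linarith)
  have hg'f : ¬ Cross g' f := hcross g' hg' f hfE (by rintro rfl; linarith)
  rcases lt_trichotomy g'.1.1 e.1.1 with h | h | h
  · have h1 := height_le_of_not_cross heg' (x := w.1) (y := e.1.1) (by linarith) (by linarith)
      (by linarith) (by linarith) (by linarith) (by linarith) (by linarith) (by linarith) hlt
    have h2 := height_le_of_not_cross hg'f (x := w.1) (y := e.1.1) (by linarith) (by linarith)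
      (by linarith) (by linarith) (by linarith) (by linarith) (by linarith) (by linarith)
      (by linarith)
    rw [height_left] at h1
    exact hvert g' hg' e.1 heV1 h (by linarith) (by linarith)
  · have h1 : g'.1 = e.1 := hV hg'V1 heV1 h
    have h2 : slope e < slope g' := by
      simp only [height, h1] at hlt
      exact lt_of_mul_lt_mul_right (by linarith) (sub_nonneg.2 hpw.le)
    have h3 := hfmin g' ⟨hg', h1, h2⟩
    have h4 : height g' w.1 < height f w.1 := by linarith
    simp only [height, h1, hfe] at h4
    have h5 := mul_le_mul_of_nonneg_right h3 (sub_nonneg.2 hpw.le)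
    linarith
  · have h1 := height_le_of_not_cross heg' (x := w.1) (y := g'.1.1) (by linarith) (by linarith)
      (by linarith) (by linarith) (by linarith) (by linarith) (by linarith) (by linarith) hlt
    have h2 := height_le_of_not_cross hg'f (x := w.1) (y := g'.1.1) (by linarith) (by linarith)
      (by linarith) (by linarith) (by linarith) (by linarith) (by linarith) (by linarith)
      (by linarith)
    rw [height_left] at h1 h2
    have h3 := hvert e he g'.1 hg'V1 h (by linarith)
    have h4 := hwmin g'.1 ⟨hg'V1, h, by linarith, by linarith, lt_of_le_of_ne h1 h3.symm, h2⟩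
    linarith

/-- A plane straight-line graph has at most three times as many edges as vertices. -/
theorem card_edges_le_three_mul {V : Finset (ℝ × ℝ)} (hV : Set.InjOn Prod.fst (V : Set (ℝ × ℝ)))
    {E : Finset ((ℝ × ℝ) × (ℝ × ℝ))} (hE : ∀ e ∈ E, e.1 ∈ V ∧ e.2 ∈ V ∧ e.1.1 < e.2.1)
    (hvert : ∀ e ∈ E, ∀ v ∈ V, e.1.1 < v.1 → v.1 < e.2.1 → v.2 ≠ height e v.1)
    (hcross : ∀ e ∈ E, ∀ f ∈ E, e ≠ f → ¬ Cross e f) :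
    #E ≤ 3 * #V := by
  have hslope : ∀ e ∈ E, ∀ f ∈ E, slope e = slope f → (e.1 = f.1 ∨ e.2 = f.2) → e = f := by
    intro e he f hf hs hef
    by_contra hne
    apply hcross e he f hf hne
    obtain ⟨-, -, h1⟩ := hE e he
    obtain ⟨-, -, h2⟩ := hE f hf
    rcases hef with h | h
    · have h3 : e.1.1 = f.1.1 := by rw [h]
      obtain ⟨x, hx1, hx2⟩ := exists_between (lt_min h1 (h3 ▸ h2))
      rw [lt_min_iff] at hx2
      exact ⟨x, hx1, hx2.1, h3 ▸ hx1, hx2.2, by simp [height, hs, h]⟩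
    · have h3 : e.2.1 = f.2.1 := by rw [h]
      obtain ⟨x, hx1, hx2⟩ := exists_between (max_lt h1 (h3 ▸ h2))
      rw [max_lt_iff] at hx1
      exact ⟨x, hx1.1, hx2, hx1.2, h3 ▸ hx2, by
        rw [height_eq_right h1, height_eq_right h2, hs, h]⟩
  set A := E.filter fun e => ∀ f ∈ E, f.1 = e.1 → slope f ≤ slope e with hA
  set B := E.filter fun e => ∀ f ∈ E, f.2 = e.2 → slope e ≤ slope f with hB
  set C := E.filter fun e => ∃ v ∈ V, DirectlyBelow E e v with hC
  have hsub : E ⊆ A ∪ (B ∪ C) := by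
    intro e he
    simp only [hA, hB, hC, mem_union, mem_filter, he, true_and]
    by_contra! h
    obtain ⟨hl, hr, h⟩ := h
    obtain ⟨v, hv, hb⟩ := exists_directlyBelow hV hE hvert hcross he hl hr
    exact h v hv hb
  have hAc : #A ≤ #V := by
    refine card_le_card_of_injOn (fun e => e.1) ?_ ?_
    · intro e he
      exact (hE e (mem_filter.1 he).1).1
    · intro e he f hf hef
      simp only [hA, coe_filter, Set.mem_ofPred_eq] at he hf
      exact hslope e he.1 f hf.1 (le_antisymm (hf.2 e he.1 hef) (he.2 f hf.1 hef.symm)) (.inl hef)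
  have hBc : #B ≤ #V := by
    refine card_le_card_of_injOn (fun e => e.2) ?_ ?_
    · intro e he
      exact (hE e (mem_filter.1 he).1).2.1
    · intro e he f hf hef
      simp only [hB, coe_filter, Set.mem_ofPred_eq] at he hf
      exact hslope e he.1 f hf.1 (le_antisymm (he.2 f hf.1 hef.symm) (hf.2 e he.1 hef)) (.inr hef)
  have hCc : #C ≤ #V := by
    have hex : ∀ e : C, ∃ v ∈ V, DirectlyBelow E e v := fun e => (mem_filter.1 e.2).2
    choose v hv hb using hex
    rw [← card_attach]
    refine card_le_card_of_injOn v (fun e _ => hv e) ?_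
    intro e _ f _ hef
    have he := hb e
    have hf := hb f
    rw [← hef] at hf
    have heE := (mem_filter.1 e.2).1
    have hfE := (mem_filter.1 f.2).1
    have heq := le_antisymm (hf.2.2.2 e heE he.1 he.2.1 he.2.2.1)
      (he.2.2.2 f hfE hf.1 hf.2.1 hf.2.2.1)
    by_contra hne
    exact hcross e heE f hfE (fun h => hne (Subtype.ext h))
      ⟨(v e).1, he.1, he.2.1, hf.1, hf.2.1, heq⟩
  have h1 := card_le_card hsub
  have h2 := card_union_le A (B ∪ C)
  have h3 := card_union_le B C
  omega

/-- The expected number of members of the family `T` that lie in a random subset of `V`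
containing each point independently with probability `p`. -/
theorem sum_powerset_weight_mul_card {α ι : Type*} [DecidableEq α] (V : Finset α) (A : Finset ι)
    (T : ι → Finset α) (hT : ∀ i ∈ A, T i ⊆ V) (p : ℝ) :
    ∑ S ∈ V.powerset, p ^ #S * (1 - p) ^ (#V - #S) * (#{i ∈ A | T i ⊆ S} : ℝ) =
      ∑ i ∈ A, p ^ #(T i) := by
  have h1 : ∀ S ∈ V.powerset, p ^ #S * (1 - p) ^ (#V - #S) * (#{i ∈ A | T i ⊆ S} : ℝ) =
      ∑ i ∈ A, if T i ⊆ S then p ^ #S * (1 - p) ^ (#V - #S) else 0 := by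
    intro S _
    rw [← sum_filter, sum_const, nsmul_eq_mul, mul_comm]
  rw [sum_congr rfl h1, sum_comm]
  refine sum_congr rfl fun i hi => ?_
  rw [← sum_filter]
  have h2 : (V.powerset.filter fun S => T i ⊆ S) =
      (V \ T i).powerset.image fun S => T i ∪ S := by
    rw [← Icc_eq_image_powerset (hT i hi)]
    ext S
    simp [and_comm]
  have hdisj : ∀ S ∈ (V \ T i).powerset, Disjoint (T i) S := fun S hS =>
    disjoint_of_subset_right (mem_powerset.1 hS) disjoint_sdiff
  rw [h2, sum_image]
  · have h3 : ∀ S ∈ (V \ T i).powerset, p ^ #(T i ∪ S) * (1 - p) ^ (#V - #(T i ∪ S)) =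
        p ^ #(T i) * (p ^ #S * (1 - p) ^ (#(V \ T i) - #S)) := by
      intro S hS
      rw [card_union_of_disjoint (hdisj S hS), card_sdiff_of_subset (hT i hi), pow_add,
        Nat.sub_sub, mul_assoc]
    rw [sum_congr rfl h3, ← mul_sum, sum_pow_mul_eq_add_pow]
    simp
  · intro S hS S' hS' h
    have h4 := congrArg (fun R => R \ T i) h
    simpa [union_sdiff_distrib, sdiff_eq_self_of_disjoint (hdisj S hS).symm,
      sdiff_eq_self_of_disjoint (hdisj S' hS').symm] using h4

/-- The amplification step of the crossing lemma: a linear bound on the number of edges of all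
induced subgraphs forces cubically many crossings. -/
theorem card_pow_three_le {α : Type*} [DecidableEq α] {V : Finset α} {E : Finset (α × α)}
    {X : Finset ((α × α) × (α × α))} (hE : ∀ e ∈ E, e.1 ∈ V ∧ e.2 ∈ V ∧ e.1 ≠ e.2)
    (hX : ∀ c ∈ X, c.1 ∈ E ∧ c.2 ∈ E ∧ c.1.1 ≠ c.2.1 ∧ c.1.1 ≠ c.2.2 ∧ c.1.2 ≠ c.2.1 ∧
      c.1.2 ≠ c.2.2)
    (h : ∀ S ⊆ V, #{e ∈ E | {e.1, e.2} ⊆ S} ≤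
      3 * #S + #{c ∈ X | {c.1.1, c.1.2, c.2.1, c.2.2} ⊆ S})
    (hlarge : 6 * #V ≤ #E) : (#E : ℝ) ^ 3 ≤ 72 * (#V : ℝ) ^ 2 * #X := by
  have key : ∀ p : ℝ, 0 ≤ p → p ≤ 1 → p ^ 2 * #E ≤ 3 * (p * #V) + p ^ 4 * #X := by
    intro p hp0 hp1
    have h1 := sum_powerset_weight_mul_card V E (fun e => {e.1, e.2}) (fun e he => by
      simp [insert_subset_iff, hE e he]) p
    have h2 := sum_powerset_weight_mul_card V V (fun v => {v}) (fun v hv => by simpa using hv) p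
    have h3 := sum_powerset_weight_mul_card V X (fun c => {c.1.1, c.1.2, c.2.1, c.2.2})
      (fun c hc => by
        simp [insert_subset_iff, hE _ (hX c hc).1, hE _ (hX c hc).2.1]) p
    rw [sum_congr (s₁ := E) rfl (g := fun _ => p ^ 2) (fun e he => by
      rw [card_pair (hE e he).2.2])] at h1
    rw [sum_congr (s₁ := X) rfl (g := fun _ => p ^ 4) (fun c hc => by
      obtain ⟨hc1, hc2, n1, n2, n3, n4⟩ := hX c hc
      rw [card_insert_of_notMem, card_insert_of_notMem, card_pair (hE _ hc2).2.2]
      · simp [n3, n4]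
      · simp [n1, n2, (hE _ hc1).2.2])] at h3
    simp only [card_singleton, pow_one, sum_const, nsmul_eq_mul] at h1 h2 h3
    rw [mul_comm (p ^ 2), mul_comm p, mul_comm (p ^ 4), ← h1, ← h2, ← h3, mul_sum,
      ← sum_add_distrib]
    refine sum_le_sum fun S hS => ?_
    have hS' := mem_powerset.1 hS
    have hw : 0 ≤ p ^ #S * (1 - p) ^ (#V - #S) :=
      mul_nonneg (pow_nonneg hp0 _) (pow_nonneg (by linarith) _)
    have h4 : #{v ∈ V | {v} ⊆ S} = #S := by
      congr 1
      ext v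
      simp only [mem_filter, singleton_subset_iff]
      exact ⟨fun hv => hv.2, fun hv => ⟨hS' hv, hv⟩⟩
    rw [h4]
    have h5 : (#{e ∈ E | {e.1, e.2} ⊆ S} : ℝ) ≤
        3 * #S + #{c ∈ X | {c.1.1, c.1.2, c.2.1, c.2.2} ⊆ S} := mod_cast h S hS'
    linarith [mul_le_mul_of_nonneg_left h5 hw]
  rcases Nat.eq_zero_or_pos (#E) with h0 | h0
  · rw [h0]
    simp only [CharP.cast_eq_zero, ne_eq, OfNat.ofNat_ne_zero, not_false_eq_true, zero_pow]
    positivity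
  have hEpos : (0 : ℝ) < #E := by exact_mod_cast h0
  have hVpos : (0 : ℝ) < #V := by
    obtain ⟨e, he⟩ := card_pos.1 h0
    exact_mod_cast card_pos.2 ⟨e.1, (hE e he).1⟩
  have hl : 6 * (#V : ℝ) ≤ #E := by exact_mod_cast hlarge
  have h1 := key (6 * #V / #E) (by positivity) ((div_le_one hEpos).2 hl)
  have h2 : (6 * (#V : ℝ) / #E) ^ 2 * #E = 36 * (#V : ℝ) ^ 2 / #E := by field_simp; norm_num
  have h3 : 3 * (6 * (#V : ℝ) / #E * #V) = 18 * (#V : ℝ) ^ 2 / #E := by field_simp; norm_num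
  have h4 : (6 * (#V : ℝ) / #E) ^ 4 * #X =
      18 * (#V : ℝ) ^ 2 / #E * (72 * (#V : ℝ) ^ 2 * #X / (#E : ℝ) ^ 3) := by
    field_simp
    ring
  rw [h2, h3, h4] at h1
  have h5 : 36 * (#V : ℝ) ^ 2 / #E = 18 * (#V : ℝ) ^ 2 / #E * 2 := by ring
  rw [h5] at h1
  have h6 : 0 < 18 * (#V : ℝ) ^ 2 / #E := by positivity
  have h7 : 1 ≤ 72 * (#V : ℝ) ^ 2 * #X / (#E : ℝ) ^ 3 := by
    by_contra! hlt
    nlinarith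
  rwa [one_le_div (by positivity)] at h7

/-- The point `v` lies on the line with slope `l.1` and intercept `l.2`. -/
def OnLine (l v : ℝ × ℝ) : Prop := v.2 = l.1 * v.1 + l.2

theorem eq_of_height_eq {l m : ℝ × ℝ} {x y : ℝ} (hxy : x ≠ y)
    (hx : l.1 * x + l.2 = m.1 * x + m.2) (hy : l.1 * y + l.2 = m.1 * y + m.2) : l = m := by
  have h1 : l.1 = m.1 := mul_right_cancel₀ (sub_ne_zero.2 hxy) (by linarith)
  exact Prod.ext h1 (by rw [h1] at hx; linarith)

theorem height_of_onLine {e : (ℝ × ℝ) × (ℝ × ℝ)} {l : ℝ × ℝ} (he : e.1.1 < e.2.1)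
    (h1 : OnLine l e.1) (h2 : OnLine l e.2) (x : ℝ) : height e x = l.1 * x + l.2 := by
  have hs : slope e = l.1 := by
    rw [slope, div_eq_iff (by linarith), h1, h2]
    ring
  rw [height, hs, h1]
  ring

/-- The segments between consecutive points of `V` on the line `l`. -/
noncomputable def segments (V : Finset (ℝ × ℝ)) (l : ℝ × ℝ) : Finset ((ℝ × ℝ) × (ℝ × ℝ)) :=
  (V ×ˢ V).filter fun e => e.1.1 < e.2.1 ∧ OnLine l e.1 ∧ OnLine l e.2 ∧
    ∀ v ∈ V, OnLine l v → e.1.1 < v.1 → e.2.1 ≤ v.1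

theorem mem_segments {V : Finset (ℝ × ℝ)} {l : ℝ × ℝ} {e : (ℝ × ℝ) × (ℝ × ℝ)} :
    e ∈ segments V l ↔ (e.1 ∈ V ∧ e.2 ∈ V) ∧ e.1.1 < e.2.1 ∧ OnLine l e.1 ∧ OnLine l e.2 ∧
      ∀ v ∈ V, OnLine l v → e.1.1 < v.1 → e.2.1 ≤ v.1 := by
  simp [segments]

theorem segments_eq_of_overlap {V : Finset (ℝ × ℝ)}
    (hV : Set.InjOn Prod.fst (V : Set (ℝ × ℝ))) {l : ℝ × ℝ} {e f : (ℝ × ℝ) × (ℝ × ℝ)}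
    (he : e ∈ segments V l) (hf : f ∈ segments V l) {x : ℝ} (h1 : e.1.1 < x) (h2 : x < e.2.1)
    (h3 : f.1.1 < x) (h4 : x < f.2.1) : e = f := by
  obtain ⟨⟨he1, he2⟩, helt, hel1, hel2, hemin⟩ := mem_segments.1 he
  obtain ⟨⟨hf1, hf2⟩, hflt, hfl1, hfl2, hfmin⟩ := mem_segments.1 hf
  have hl : e.1.1 = f.1.1 := by
    apply le_antisymm
    · by_contra! h
      linarith [hfmin e.1 he1 hel1 h]
    · by_contra! h
      linarith [hemin f.1 hf1 hfl1 h]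
  have hr : e.2.1 = f.2.1 :=
    le_antisymm (hemin f.2 hf2 hfl2 (by linarith)) (hfmin e.2 he2 hel2 (by linarith))
  exact Prod.ext (hV he1 hf1 hl) (hV he2 hf2 hr)

theorem card_points_le_card_segments {V : Finset (ℝ × ℝ)}
    (hV : Set.InjOn Prod.fst (V : Set (ℝ × ℝ))) (l : ℝ × ℝ) :
    #(V.filter (OnLine l)) - 1 ≤ #(segments V l) := by
  set A := V.filter (OnLine l) with hA
  rcases A.eq_empty_or_nonempty with h0 | h0
  · simp [h0]
  obtain ⟨t, ht, htmax⟩ := A.exists_max_image Prod.fst h0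
  rw [← card_erase_of_mem ht]
  refine (card_le_card (t := (segments V l).image Prod.fst) ?_).trans card_image_le
  intro p hp
  obtain ⟨hpt, hp⟩ := mem_erase.1 hp
  have hpA := mem_filter.1 hp
  have hlt : p.1 < t.1 := lt_of_le_of_ne (htmax p hp) fun h =>
    hpt (hV hpA.1 (mem_filter.1 ht).1 h)
  obtain ⟨q, hq, hqmin⟩ := (A.filter fun q => p.1 < q.1).exists_min_image Prod.fst
    ⟨t, by simp [ht, hlt]⟩
  obtain ⟨hqA, hpq⟩ := mem_filter.1 hq
  obtain ⟨hqV, hql⟩ := mem_filter.1 hqA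
  refine mem_image.2 ⟨(p, q), mem_segments.2 ⟨⟨hpA.1, hqV⟩, hpq, hpA.2, hql, ?_⟩, rfl⟩
  intro v hv hvl hpv
  exact hqmin v (by simp [hA, hv, hvl, show p.1 < v.1 from hpv])

theorem card_mul_le_card_biUnion_segments {V : Finset (ℝ × ℝ)}
    (hV : Set.InjOn Prod.fst (V : Set (ℝ × ℝ))) {L : Finset (ℝ × ℝ)} {k : ℕ}
    (hL : ∀ l ∈ L, k ≤ #(V.filter (OnLine l))) :
    #L * (k - 1) ≤ #(L.biUnion (segments V)) := by
  rw [card_biUnion]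
  · rw [← smul_eq_mul]
    exact card_nsmul_le_sum _ _ _ fun l hl =>
      (Nat.sub_le_sub_right (hL l hl) 1).trans (card_points_le_card_segments hV l)
  · intro l _ m _ hlm
    refine disjoint_left.2 fun e he hf => hlm ?_
    obtain ⟨-, helt, h1, h2, -⟩ := mem_segments.1 he
    obtain ⟨-, -, h3, h4, -⟩ := mem_segments.1 hf
    exact eq_of_height_eq helt.ne (h1.symm.trans h3) (h2.symm.trans h4)

/-- The ordered pairs of crossing segments of `E`. -/
noncomputable def crossings (E : Finset ((ℝ × ℝ) × (ℝ × ℝ))) :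
    Finset (((ℝ × ℝ) × (ℝ × ℝ)) × ((ℝ × ℝ) × (ℝ × ℝ))) :=
  (E ×ˢ E).filter fun c => c.1 ≠ c.2 ∧ Cross c.1 c.2

theorem mem_crossings {E : Finset ((ℝ × ℝ) × (ℝ × ℝ))}
    {c : ((ℝ × ℝ) × (ℝ × ℝ)) × ((ℝ × ℝ) × (ℝ × ℝ))} :
    c ∈ crossings E ↔ (c.1 ∈ E ∧ c.2 ∈ E) ∧ c.1 ≠ c.2 ∧ Cross c.1 c.2 := by
  simp [crossings]

/-- Crossing segments lie on different lines, which meet at the crossing point. -/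
theorem exists_crossing_lines {V : Finset (ℝ × ℝ)}
    (hV : Set.InjOn Prod.fst (V : Set (ℝ × ℝ))) {l m : ℝ × ℝ} {e f : (ℝ × ℝ) × (ℝ × ℝ)}
    (he : e ∈ segments V l) (hf : f ∈ segments V m) (hef : e ≠ f) (hc : Cross e f) :
    l ≠ m ∧ ∃ x, e.1.1 < x ∧ x < e.2.1 ∧ f.1.1 < x ∧ x < f.2.1 ∧
      l.1 * x + l.2 = m.1 * x + m.2 := by
  obtain ⟨x, h1, h2, h3, h4, hx⟩ := hc
  obtain ⟨-, helt, hel1, hel2, -⟩ := mem_segments.1 he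
  obtain ⟨-, hflt, hfl1, hfl2, -⟩ := mem_segments.1 hf
  rw [height_of_onLine helt hel1 hel2, height_of_onLine hflt hfl1 hfl2] at hx
  refine ⟨?_, x, h1, h2, h3, h4, hx⟩
  rintro rfl
  exact hef (segments_eq_of_overlap hV he hf h1 h2 h3 h4)

theorem card_crossings_le {V : Finset (ℝ × ℝ)}
    (hV : Set.InjOn Prod.fst (V : Set (ℝ × ℝ))) (L : Finset (ℝ × ℝ)) :
    #(crossings (L.biUnion (segments V))) ≤ #L ^ 2 := by
  have hex : ∀ e, ∃ l, e ∈ L.biUnion (segments V) → l ∈ L ∧ e ∈ segments V l := by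
    intro e
    by_cases he : e ∈ L.biUnion (segments V)
    · obtain ⟨l, hl⟩ := mem_biUnion.1 he
      exact ⟨l, fun _ => hl⟩
    · exact ⟨0, fun h => absurd h he⟩
  choose line hline using hex
  rw [sq, ← card_product]
  refine card_le_card_of_injOn (fun c => (line c.1, line c.2)) ?_ ?_
  · intro c hc
    obtain ⟨⟨h1, h2⟩, -⟩ := mem_crossings.1 hc
    exact mem_coe.2 (mem_product.2 ⟨(hline _ h1).1, (hline _ h2).1⟩)
  · intro c hc d hd hcd
    obtain ⟨⟨hc1, hc2⟩, hcne, hcc⟩ := mem_crossings.1 hc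
    obtain ⟨⟨hd1, hd2⟩, hdne, hdc⟩ := mem_crossings.1 hd
    obtain ⟨h1, h2⟩ := Prod.mk.inj hcd
    obtain ⟨hne, x, hx1, hx2, hx3, hx4, hx⟩ :=
      exists_crossing_lines hV (hline _ hc1).2 (hline _ hc2).2 hcne hcc
    obtain ⟨-, y, hy1, hy2, hy3, hy4, hy⟩ :=
      exists_crossing_lines hV (hline _ hd1).2 (hline _ hd2).2 hdne hdc
    rw [← h1, ← h2] at hy
    obtain rfl : x = y := by
      by_contra hxy
      exact hne (eq_of_height_eq hxy hx hy)
    exact Prod.ext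
      (segments_eq_of_overlap hV (hline _ hc1).2 (h1 ▸ (hline _ hd1).2) hx1 hx2 hy1 hy2)
      (segments_eq_of_overlap hV (hline _ hc2).2 (h2 ▸ (hline _ hd2).2) hx3 hx4 hy3 hy4)

/-- The linear crossing bound for the induced subgraphs of the segment graph. -/
theorem card_induced_segments_le {V : Finset (ℝ × ℝ)}
    (hV : Set.InjOn Prod.fst (V : Set (ℝ × ℝ))) (L : Finset (ℝ × ℝ)) {S : Finset (ℝ × ℝ)}
    (hS : S ⊆ V) :
    #{e ∈ L.biUnion (segments V) | {e.1, e.2} ⊆ S} ≤ 3 * #S +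
      #{c ∈ crossings (L.biUnion (segments V)) | {c.1.1, c.1.2, c.2.1, c.2.2} ⊆ S} := by
  set E := L.biUnion (segments V) with hE
  set ES := E.filter fun e => {e.1, e.2} ⊆ S with hES
  set XS := (crossings E).filter fun c => {c.1.1, c.1.2, c.2.1, c.2.2} ⊆ S with hXS
  have hplane : #(ES \ XS.image Prod.fst) ≤ 3 * #S := by
    apply card_edges_le_three_mul (hV.mono (coe_subset.2 hS))
    · intro e he
      obtain ⟨heE, heS⟩ := mem_filter.1 (mem_sdiff.1 he).1
      obtain ⟨l, -, hl⟩ := mem_biUnion.1 heE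
      simp only [insert_subset_iff, singleton_subset_iff] at heS
      exact ⟨heS.1, heS.2, (mem_segments.1 hl).2.1⟩
    · intro e he v hv h1 h2 h
      obtain ⟨heE, -⟩ := mem_filter.1 (mem_sdiff.1 he).1
      obtain ⟨l, -, hl⟩ := mem_biUnion.1 heE
      obtain ⟨-, helt, hl1, hl2, hmin⟩ := mem_segments.1 hl
      rw [height_of_onLine helt hl1 hl2] at h
      exact (hmin v (hS hv) h h1).not_gt h2
    · intro e he f hf hef hc
      obtain ⟨he, heX⟩ := mem_sdiff.1 he
      obtain ⟨heE, heS⟩ := mem_filter.1 he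
      obtain ⟨hfE, hfS⟩ := mem_filter.1 (mem_sdiff.1 hf).1
      refine heX (mem_image.2 ⟨(e, f), ?_, rfl⟩)
      simp only [insert_subset_iff, singleton_subset_iff] at heS hfS
      simp only [hXS, mem_filter, mem_crossings, insert_subset_iff, singleton_subset_iff]
      exact ⟨⟨⟨heE, hfE⟩, hef, hc⟩, heS.1, heS.2, hfS.1, hfS.2⟩
  have h1 := le_card_sdiff (XS.image Prod.fst) ES
  have h2 : #(XS.image Prod.fst) ≤ #XS := card_image_le
  omega

/-- The Szemerédi–Trotter bound on the number of `k`-rich lines. -/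
theorem card_rich_lines_le {V : Finset (ℝ × ℝ)}
    (hV : Set.InjOn Prod.fst (V : Set (ℝ × ℝ))) {L : Finset (ℝ × ℝ)} {k : ℕ} (hk : 2 ≤ k)
    (hL : ∀ l ∈ L, k ≤ #(V.filter (OnLine l))) :
    (#L : ℝ) ≤ 576 * (#V : ℝ) ^ 2 / (k : ℝ) ^ 3 + 12 * #V / k := by
  have hk0 : (2 : ℝ) ≤ k := by exact_mod_cast hk
  have hLE : (#L : ℝ) * (k / 2) ≤ #(L.biUnion (segments V)) := by
    have h := card_mul_le_card_biUnion_segments hV hL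
    have h' : (#L : ℝ) * (k - 1) ≤ #(L.biUnion (segments V)) := by
      have : ((k - 1 : ℕ) : ℝ) = k - 1 := by push_cast [Nat.cast_sub (by omega : 1 ≤ k)]; ring
      rw [← this]
      exact_mod_cast h
    exact (mul_le_mul_of_nonneg_left (by linarith) (Nat.cast_nonneg _)).trans h'
  rcases le_or_gt (6 * #V) #(L.biUnion (segments V)) with hlarge | hsmall
  · have h3 := card_pow_three_le (V := V) (E := L.biUnion (segments V))
      (X := crossings (L.biUnion (segments V))) ?_ ?_
      (fun S hS => card_induced_segments_le hV L hS) hlarge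
    · have hX : (#(crossings (L.biUnion (segments V))) : ℝ) ≤ (#L : ℝ) ^ 2 := by
        exact_mod_cast card_crossings_le hV L
      have h4 : ((#L : ℝ) * (k / 2)) ^ 3 ≤ 72 * (#V : ℝ) ^ 2 * (#L : ℝ) ^ 2 :=
        (pow_le_pow_left₀ (by positivity) hLE 3).trans
          (h3.trans (mul_le_mul_of_nonneg_left hX (by positivity)))
      have h5 : (#L : ℝ) ≤ 576 * (#V : ℝ) ^ 2 / (k : ℝ) ^ 3 := by
        rw [le_div_iff₀ (by positivity)]
        rcases (Nat.cast_nonneg (#L) : (0 : ℝ) ≤ #L).eq_or_lt with h0 | h0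
        · rw [← h0]
          simp only [zero_mul]
          positivity
        · refine le_of_mul_le_mul_right (a := (#L : ℝ) ^ 2) ?_ (by positivity)
          linarith [show ((#L : ℝ) * (k / 2)) ^ 3 = (#L * (k : ℝ) ^ 3 * #L ^ 2) / 8 by ring]
      have : (0 : ℝ) ≤ 12 * #V / k := by positivity
      linarith
    · intro e he
      obtain ⟨l, -, hl⟩ := mem_biUnion.1 he
      obtain ⟨⟨h1, h2⟩, hlt, -⟩ := mem_segments.1 hl
      exact ⟨h1, h2, fun h => hlt.ne (congrArg Prod.fst h)⟩
    · intro c hc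
      obtain ⟨⟨hc1, hc2⟩, hne, hcr⟩ := mem_crossings.1 hc
      obtain ⟨l, -, hl⟩ := mem_biUnion.1 hc1
      obtain ⟨m, -, hm⟩ := mem_biUnion.1 hc2
      obtain ⟨hlm, x, hx1, hx2, hx3, hx4, hx⟩ := exists_crossing_lines hV hl hm hne hcr
      obtain ⟨-, -, hl1, hl2, -⟩ := mem_segments.1 hl
      obtain ⟨-, -, hm1, hm2, -⟩ := mem_segments.1 hm
      have hmeet : ∀ p q : ℝ × ℝ, OnLine l p → OnLine m q → p.1 ≠ x → p ≠ q := by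
        rintro p q hp hq hpx rfl
        exact hlm (eq_of_height_eq hpx (hp.symm.trans hq) hx)
      exact ⟨hc1, hc2, hmeet _ _ hl1 hm1 hx1.ne, hmeet _ _ hl1 hm2 hx1.ne,
        hmeet _ _ hl2 hm1 hx2.ne', hmeet _ _ hl2 hm2 hx2.ne'⟩
  · have h1 : (#(L.biUnion (segments V)) : ℝ) < 6 * #V := by exact_mod_cast hsmall
    have h2 : (#L : ℝ) ≤ 12 * #V / k := by
      rw [le_div_iff₀ (by positivity)]
      linarith
    have : (0 : ℝ) ≤ 576 * (#V : ℝ) ^ 2 / (k : ℝ) ^ 3 := by positivity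
    linarith

theorem collinear_image {s : Set (ℝ × ℝ)} (h : Collinear ℝ s)
    (f : ℝ × ℝ →ₗ[ℝ] ℝ × ℝ) : Collinear ℝ (f '' s) := by
  obtain ⟨p, v, hp⟩ := (collinear_iff_exists_forall_eq_smul_vadd s).1 h
  refine (collinear_iff_exists_forall_eq_smul_vadd _).2 ⟨f p, f v, ?_⟩
  rintro _ ⟨x, hx, rfl⟩
  obtain ⟨r, rfl⟩ := hp x hx
  exact ⟨r, by simp⟩

theorem collinear_of_onLine {s : Set (ℝ × ℝ)} {l : ℝ × ℝ} (h : ∀ v ∈ s, OnLine l v) :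
    Collinear ℝ s := by
  refine (collinear_iff_exists_forall_eq_smul_vadd s).2 ⟨(0, l.2), (1, l.1), fun v hv => ?_⟩
  refine ⟨v.1, Prod.ext (by simp) ?_⟩
  rw [h v hv]
  simp [mul_comm]

theorem exists_onLine_of_collinear {s : Set (ℝ × ℝ)} (h : Collinear ℝ s) {p q : ℝ × ℝ}
    (hp : p ∈ s) (hq : q ∈ s) (hpq : p.1 ≠ q.1) : ∃ l, ∀ v ∈ s, OnLine l v := by
  obtain ⟨o, d, hd⟩ := (collinear_iff_exists_forall_eq_smul_vadd s).1 h
  have hd1 : d.1 ≠ 0 := by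
    intro h0
    obtain ⟨r, rfl⟩ := hd p hp
    obtain ⟨r', rfl⟩ := hd q hq
    simp [h0] at hpq
  refine ⟨(d.2 / d.1, o.2 - d.2 / d.1 * o.1), fun v hv => ?_⟩
  obtain ⟨r, rfl⟩ := hd v hv
  simp only [OnLine, vadd_eq_add, Prod.fst_add, Prod.snd_add, Prod.smul_fst, Prod.smul_snd,
    smul_eq_mul]
  field_simp
  ring

/-- The shear `(x, y) ↦ (x + t * y, y)`. -/
def shear (t : ℝ) : ℝ × ℝ →ₗ[ℝ] ℝ × ℝ where
  toFun p := (p.1 + t * p.2, p.2)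
  map_add' p q := Prod.ext (by simp; ring) (by simp)
  map_smul' r p := Prod.ext (by simp; ring) (by simp)

theorem shear_neg_shear (t : ℝ) (p : ℝ × ℝ) : shear (-t) (shear t p) = p := by
  simp [shear]

theorem exists_shear_injOn (P : Finset (ℝ × ℝ)) :
    ∃ t, ∀ p ∈ P, ∀ q ∈ P, (shear t p).1 = (shear t q).1 → p = q := by
  obtain ⟨t, ht⟩ := Infinite.exists_notMem_finset
    ((P ×ˢ P).image fun e => -(e.1.1 - e.2.1) / (e.1.2 - e.2.2))
  refine ⟨t, fun p hp q hq h => ?_⟩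
  simp only [shear, LinearMap.coe_mk, AddHom.coe_mk] at h
  by_cases h2 : p.2 = q.2
  · rw [h2] at h
    exact Prod.ext (by linarith) h2
  · refine absurd (mem_image.2 ⟨(p, q), by simp [hp, hq], ?_⟩) ht
    rw [div_eq_iff (sub_ne_zero.2 h2)]
    linarith

theorem choose_three_le_sum_sq (k : ℕ) : k.choose 3 ≤ ∑ j ∈ Icc 3 k, j ^ 2 := by
  induction k with
  | zero => simp
  | succ k ih =>
    rcases lt_or_ge k 2 with hk | hk
    · interval_cases k <;> simp [Nat.choose]
    · rw [Nat.choose_succ_succ' k 2, sum_Icc_succ_top (by omega), add_comm]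
      gcongr
      exact (Nat.choose_le_pow k 2).trans (Nat.pow_le_pow_left (Nat.le_succ k) 2)

/-- The set of collinear triples of `P`. -/
noncomputable def collinearTriples (P : Finset (ℝ × ℝ)) : Finset (Finset (ℝ × ℝ)) :=
  (P.powersetCard 3).filter fun T => Collinear ℝ (T : Set (ℝ × ℝ))

theorem mem_collinearTriples {P T : Finset (ℝ × ℝ)} :
    T ∈ collinearTriples P ↔ (T ⊆ P ∧ #T = 3) ∧ Collinear ℝ (T : Set (ℝ × ℝ)) := by
  simp [collinearTriples, mem_powersetCard]

/-- The collinear triples are counted by the rich lines. -/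
theorem exists_lines_card_collinearTriples_le {V : Finset (ℝ × ℝ)}
    (hV : Set.InjOn Prod.fst (V : Set (ℝ × ℝ))) {ℓ : ℕ} (hℓ : AtMostCollinear V ℓ) :
    ∃ L : Finset (ℝ × ℝ), #(collinearTriples V) ≤
      ∑ j ∈ Icc 3 ℓ, j ^ 2 * #(L.filter fun l => j ≤ #(V.filter (OnLine l))) := by
  have hex : ∀ T, ∃ l, T ∈ collinearTriples V → ∀ v ∈ T, OnLine l v := by
    intro T
    by_cases hT : T ∈ collinearTriples V
    · obtain ⟨⟨hTV, hT3⟩, hTc⟩ := mem_collinearTriples.1 hT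
      obtain ⟨p, hp, q, hq, hpq⟩ := one_lt_card.1 (by omega : 1 < #T)
      obtain ⟨l, hl⟩ := exists_onLine_of_collinear hTc hp hq
        fun h => hpq (hV (hTV hp) (hTV hq) h)
      exact ⟨l, fun _ => hl⟩
    · exact ⟨0, fun h => absurd h hT⟩
  choose line hline using hex
  refine ⟨(collinearTriples V).image line, ?_⟩
  set L := (collinearTriples V).image line with hL
  have h1 : collinearTriples V ⊆ L.biUnion fun l => (V.filter (OnLine l)).powersetCard 3 := by
    intro T hT
    obtain ⟨⟨hTV, hT3⟩, -⟩ := mem_collinearTriples.1 hT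
    exact mem_biUnion.2 ⟨line T, mem_image_of_mem _ hT, mem_powersetCard.2
      ⟨fun v hv => mem_filter.2 ⟨hTV hv, hline T hT v hv⟩, hT3⟩⟩
  calc #(collinearTriples V)
      ≤ ∑ l ∈ L, #((V.filter (OnLine l)).powersetCard 3) :=
        (card_le_card h1).trans card_biUnion_le
    _ ≤ ∑ l ∈ L, ∑ j ∈ Icc 3 ℓ, if j ≤ #(V.filter (OnLine l)) then j ^ 2 else 0 := by
        refine sum_le_sum fun l _ => ?_
        rw [card_powersetCard, ← sum_filter]
        refine (choose_three_le_sum_sq _).trans (sum_le_sum_of_subset fun j hj => ?_)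
        have h2 : #(V.filter (OnLine l)) ≤ ℓ := hℓ _ (filter_subset _ _)
          (collinear_of_onLine fun v hv => (mem_filter.1 (mem_coe.1 hv)).2)
        simp only [mem_Icc, mem_filter] at hj ⊢
        omega
    _ = ∑ j ∈ Icc 3 ℓ, j ^ 2 * #(L.filter fun l => j ≤ #(V.filter (OnLine l))) := by
        rw [sum_comm]
        refine sum_congr rfl fun j _ => ?_
        rw [← sum_filter, sum_const, smul_eq_mul, mul_comm]

theorem sum_Icc_inv_le {ℓ : ℕ} (hℓ : 3 ≤ ℓ) : ∑ j ∈ Icc 3 ℓ, (j : ℝ)⁻¹ ≤ 2 * Real.log ℓ := by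
  have h1 : ∑ j ∈ Icc 3 ℓ, (j : ℝ)⁻¹ ≤ ∑ j ∈ Icc 1 ℓ, (j : ℝ)⁻¹ :=
    sum_le_sum_of_subset_of_nonneg (Icc_subset_Icc_left (by norm_num))
      fun _ _ _ => by positivity
  have h2 := harmonic_le_one_add_log ℓ
  rw [harmonic_eq_sum_Icc] at h2
  push_cast at h2
  have h3 : 1 ≤ Real.log ℓ := by
    rw [Real.le_log_iff_exp_le (by positivity)]
    have : (3 : ℝ) ≤ ℓ := by exact_mod_cast hℓ
    linarith [Real.exp_one_lt_d9]
  linarith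

theorem card_collinearTriples_le_of_injOn {V : Finset (ℝ × ℝ)}
    (hV : Set.InjOn Prod.fst (V : Set (ℝ × ℝ))) {ℓ : ℕ} (hℓ3 : 3 ≤ ℓ)
    (hℓ : AtMostCollinear V ℓ) :
    (#(collinearTriples V) : ℝ) ≤
      1152 * ((#V : ℝ) ^ 2 * Real.log ℓ + (ℓ : ℝ) ^ 2 * #V) := by
  obtain ⟨L, hL⟩ := exists_lines_card_collinearTriples_le hV hℓ
  calc (#(collinearTriples V) : ℝ)
      ≤ ∑ j ∈ Icc 3 ℓ, (j : ℝ) ^ 2 * #(L.filter fun l => j ≤ #(V.filter (OnLine l))) := by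
        exact_mod_cast hL
    _ ≤ ∑ j ∈ Icc 3 ℓ, (576 * (#V : ℝ) ^ 2 * (j : ℝ)⁻¹ + 12 * #V * ℓ) := by
        refine sum_le_sum fun j hj => ?_
        obtain ⟨hj3, hjℓ⟩ := mem_Icc.1 hj
        have hj0 : (0 : ℝ) < j := by exact_mod_cast (by omega : 0 < j)
        have hjℓ' : (j : ℝ) ≤ ℓ := by exact_mod_cast hjℓ
        have h := card_rich_lines_le hV (by omega : 2 ≤ j)
          (L := L.filter fun l => j ≤ #(V.filter (OnLine l))) fun l hl => (mem_filter.1 hl).2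
        calc (j : ℝ) ^ 2 * #(L.filter fun l => j ≤ #(V.filter (OnLine l)))
            ≤ (j : ℝ) ^ 2 * (576 * (#V : ℝ) ^ 2 / (j : ℝ) ^ 3 + 12 * #V / j) := by gcongr
          _ = 576 * (#V : ℝ) ^ 2 * (j : ℝ)⁻¹ + 12 * #V * j := by field_simp
          _ ≤ _ := by gcongr
    _ ≤ 576 * (#V : ℝ) ^ 2 * (2 * Real.log ℓ) + ℓ * (12 * #V * ℓ) := by
        rw [sum_add_distrib, ← mul_sum, sum_const, nsmul_eq_mul, Nat.card_Icc]
        gcongr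
        · exact sum_Icc_inv_le hℓ3
        · omega
    _ ≤ _ := by
        have : (0 : ℝ) ≤ (ℓ : ℝ) ^ 2 * #V := by positivity
        linarith

theorem card_collinearTriples_le {P : Finset (ℝ × ℝ)} {ℓ : ℕ} (hℓ3 : 3 ≤ ℓ)
    (hℓ : AtMostCollinear P ℓ) :
    (#(collinearTriples P) : ℝ) ≤
      1152 * ((#P : ℝ) ^ 2 * Real.log ℓ + (ℓ : ℝ) ^ 2 * #P) := by
  obtain ⟨t, ht⟩ := exists_shear_injOn P
  have hleft : Function.LeftInverse (shear (-t)) (shear t) := shear_neg_shear t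
  have hinv : ∀ p, shear t (shear (-t) p) = p := fun p => by
    simpa using shear_neg_shear (-t) p
  set V := P.image (shear t) with hVdef
  have hcard : #V = #P := card_image_of_injective _ hleft.injective
  have hV : Set.InjOn Prod.fst (V : Set (ℝ × ℝ)) := by
    intro v hv w hw h
    obtain ⟨p, hp, rfl⟩ := mem_image.1 (mem_coe.1 hv)
    obtain ⟨q, hq, rfl⟩ := mem_image.1 (mem_coe.1 hw)
    rw [ht p hp q hq h]
  have hVℓ : AtMostCollinear V ℓ := by
    intro T hT hTc
    have hinj : Function.Injective (shear (-t)) :=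
      Function.LeftInverse.injective (g := shear t) hinv
    rw [← card_image_of_injective T hinj]
    refine hℓ _ ?_ ?_
    · intro p hp
      obtain ⟨v, hv, rfl⟩ := mem_image.1 hp
      obtain ⟨q, hq, rfl⟩ := mem_image.1 (hT hv)
      rwa [shear_neg_shear]
    · rw [coe_image]
      exact collinear_image hTc _
  have htriples : #(collinearTriples P) ≤ #(collinearTriples V) := by
    refine card_le_card_of_injOn (image (shear t)) ?_ (image_injective hleft.injective).injOn
    intro T hT
    obtain ⟨⟨hTP, hT3⟩, hTc⟩ := mem_collinearTriples.1 (mem_coe.1 hT)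
    refine mem_coe.2 (mem_collinearTriples.2 ⟨⟨image_subset_image hTP, ?_⟩, ?_⟩)
    · rw [card_image_of_injective _ hleft.injective, hT3]
    · rw [coe_image]
      exact collinear_image hTc _
  have h := card_collinearTriples_le_of_injOn hV hℓ3 hVℓ
  rw [hcard] at h
  exact le_trans (by exact_mod_cast htriples) h

end SzemerediTrotter

/-- There is an absolute constant `c > 0` such that every set of `n` points in the plane
with at most `ℓ` collinear (`ℓ ≥ 3`) has at most `c·(n²·log ℓ + ℓ²·n)` collinear triples. -/
theorem number_of_collinear_triples :
    ∃ c : ℝ, 0 < c ∧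
      ∀ (ℓ n : ℕ) (P : Finset (ℝ × ℝ)),
        3 ≤ ℓ → P.card = n → AtMostCollinear P ℓ →
        (((P.powersetCard 3).filter
            (fun T => Collinear ℝ (T : Set (ℝ × ℝ)))).card : ℝ)
          ≤ c * ((n : ℝ) ^ 2 * Real.log ℓ + (ℓ : ℝ) ^ 2 * n) := by
  refine ⟨1152, by norm_num, ?_⟩
  rintro ℓ n P hℓ3 rfl hℓ
  refine le_trans (Nat.cast_le.2 ?_) (SzemerediTrotter.card_collinearTriples_le hℓ3 hℓ)
  refine (Finset.card_le_card ?_).trans (Finset.card_image_le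
    (s := SzemerediTrotter.collinearTriples P) (f := fun T => (T : Set (ℝ × ℝ))))
  intro T hT
  simp only [Finset.bind_def, Finset.pure_def, Finset.mem_filter, Finset.mem_sup,
    Finset.mem_singleton] at hT
  obtain ⟨⟨S, hS, rfl⟩, hc⟩ := hT
  exact Finset.mem_image.2 ⟨S, Finset.mem_filter.2 ⟨hS, hc⟩, rfl⟩
end

section
/- For every constant d > 0 there exists a constant c > 0 such that the following holds. Let n and ℓ be integers with 3 ≤ ℓ ≤ d·√n, and let P be a set of n points in the plane ℝ² with at most ℓ collinear. Then P contains a subset of at least c·√(n / log ℓ) points in general position. -/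
/-- A finite point set is in general position if no three of its points are collinear. -/
def GeneralPosition (S : Finset (ℝ × ℝ)) : Prop :=
  ∀ T ⊆ S, Collinear ℝ (T : Set (ℝ × ℝ)) → T.card ≤ 2

/-- The line `y = a * x + b` through the two endpoints of `e`, encoded as `(a, b)`. -/
noncomputable def edgeLine (e : (ℝ × ℝ) × (ℝ × ℝ)) : ℝ × ℝ :=
  ((e.2.2 - e.1.2) / (e.2.1 - e.1.1),
    e.1.2 - (e.2.2 - e.1.2) / (e.2.1 - e.1.1) * e.1.1)

/-- The height over `x` of the line through the two endpoints of `e`. -/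
noncomputable def edgeHeight (e : (ℝ × ℝ) × (ℝ × ℝ)) (x : ℝ) : ℝ :=
  (edgeLine e).1 * x + (edgeLine e).2

/-- Two segments cross if their interiors meet. -/
def Crosses (e f : (ℝ × ℝ) × (ℝ × ℝ)) : Prop :=
  ∃ x, e.1.1 < x ∧ x < e.2.1 ∧ f.1.1 < x ∧ x < f.2.1 ∧ edgeHeight e x = edgeHeight f x

/-- A straight-line drawing of a graph: the vertices have distinct abscissae, edges are directed
from left to right, and no vertex lies in the interior of an edge. -/
structure IsDrawing (P : Finset (ℝ × ℝ)) (E : Finset ((ℝ × ℝ) × (ℝ × ℝ))) : Prop where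
  inj : Set.InjOn Prod.fst (P : Set (ℝ × ℝ))
  left_mem : ∀ e ∈ E, e.1 ∈ P
  right_mem : ∀ e ∈ E, e.2 ∈ P
  lt : ∀ e ∈ E, e.1.1 < e.2.1
  height_ne : ∀ e ∈ E, ∀ v ∈ P, e.1.1 < v.1 → v.1 < e.2.1 → edgeHeight e v.1 ≠ v.2

lemma edgeHeight_left (e : (ℝ × ℝ) × (ℝ × ℝ)) : edgeHeight e e.1.1 = e.1.2 := by
  simp [edgeHeight, edgeLine]

lemma edgeHeight_right {e : (ℝ × ℝ) × (ℝ × ℝ)} (h : e.1.1 < e.2.1) :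
    edgeHeight e e.2.1 = e.2.2 := by
  have : e.2.1 - e.1.1 ≠ 0 := by linarith
  simp only [edgeHeight, edgeLine]
  field_simp
  ring

lemma edgeLine_eq {e : (ℝ × ℝ) × (ℝ × ℝ)} {L : ℝ × ℝ} (h : e.1.1 < e.2.1)
    (h₁ : e.1.2 = L.1 * e.1.1 + L.2) (h₂ : e.2.2 = L.1 * e.2.1 + L.2) : edgeLine e = L := by
  have h0 : e.2.1 - e.1.1 ≠ 0 := by linarith
  have hs : (e.2.2 - e.1.2) / (e.2.1 - e.1.1) = L.1 := by
    rw [div_eq_iff h0, h₁, h₂]; ring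
  ext
  · exact hs
  · simp only [edgeLine, hs]; linarith

lemma edgeHeight_eq_add (e : (ℝ × ℝ) × (ℝ × ℝ)) (x : ℝ) :
    edgeHeight e x = e.1.2 + (edgeLine e).1 * (x - e.1.1) := by
  simp only [edgeHeight, edgeLine]; ring

lemma continuous_edgeHeight (e : (ℝ × ℝ) × (ℝ × ℝ)) : Continuous (edgeHeight e) := by
  unfold edgeHeight; fun_prop

lemma edgeHeight_lt_of_not_crosses {e f : (ℝ × ℝ) × (ℝ × ℝ)} (hc : ¬ Crosses e f) {x y : ℝ}
    (hx1 : e.1.1 ≤ x) (hx2 : x ≤ e.2.1) (hx3 : f.1.1 ≤ x) (hx4 : x ≤ f.2.1)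
    (hy1 : e.1.1 < y) (hy2 : y < e.2.1) (hy3 : f.1.1 < y) (hy4 : y < f.2.1)
    (h : edgeHeight e x < edgeHeight f x) : edgeHeight e y < edgeHeight f y := by
  by_contra! hle
  have hcont : ContinuousOn (fun z => edgeHeight f z - edgeHeight e z) (Set.uIcc y x) :=
    ((continuous_edgeHeight f).sub (continuous_edgeHeight e)).continuousOn
  have h0 : (0 : ℝ) ∈ Set.uIcc (edgeHeight f y - edgeHeight e y)
      (edgeHeight f x - edgeHeight e x) := by
    rw [Set.mem_uIcc]; left; constructor <;> linarith
  obtain ⟨z, hz, hz0⟩ := intermediate_value_uIcc hcont h0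
  have hz0 : edgeHeight f z - edgeHeight e z = 0 := hz0
  have hzx : z ≠ x := by rintro rfl; linarith
  apply hc
  rcases Set.mem_uIcc.1 hz with ⟨ha, hb⟩ | ⟨ha, hb⟩
  · have := lt_of_le_of_ne hb hzx
    exact ⟨z, by linarith, by linarith, by linarith, by linarith, by linarith⟩
  · have := lt_of_le_of_ne ha hzx.symm
    exact ⟨z, by linarith, by linarith, by linarith, by linarith, by linarith⟩

namespace IsDrawing

variable {P : Finset (ℝ × ℝ)} {E : Finset ((ℝ × ℝ) × (ℝ × ℝ))}

lemma eq_of_fst_eq (hD : IsDrawing P E) {p q : ℝ × ℝ} (hp : p ∈ P) (hq : q ∈ P)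
    (h : p.1 = q.1) : p = q :=
  hD.inj hp hq h

lemma mono (hD : IsDrawing P E) {P' : Finset (ℝ × ℝ)} {E' : Finset ((ℝ × ℝ) × (ℝ × ℝ))}
    (hP : P' ⊆ P) (hE : E' ⊆ E) (hl : ∀ e ∈ E', e.1 ∈ P') (hr : ∀ e ∈ E', e.2 ∈ P') :
    IsDrawing P' E' where
  inj := hD.inj.mono (by exact_mod_cast hP)
  left_mem := hl
  right_mem := hr
  lt e he := hD.lt e (hE he)
  height_ne e he v hv := hD.height_ne e (hE he) v (hP hv)

lemma left_le_of_edgeLine_eq (hD : IsDrawing P E) {e f : (ℝ × ℝ) × (ℝ × ℝ)} (he : e ∈ E)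
    (hf : f ∈ E) (hL : edgeLine e = edgeLine f) {x : ℝ} (h2 : x < e.2.1) (h3 : f.1.1 < x) :
    f.1.1 ≤ e.1.1 := by
  by_contra! h
  apply hD.height_ne e he f.1 (hD.left_mem f hf) h (h3.trans h2)
  rw [edgeHeight, hL, ← edgeHeight, edgeHeight_left]

lemma right_le_of_edgeLine_eq (hD : IsDrawing P E) {e f : (ℝ × ℝ) × (ℝ × ℝ)} (he : e ∈ E)
    (hf : f ∈ E) (hL : edgeLine e = edgeLine f) {x : ℝ} (h1 : e.1.1 < x) (h4 : x < f.2.1) :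
    e.2.1 ≤ f.2.1 := by
  by_contra! h
  apply hD.height_ne e he f.2 (hD.right_mem f hf) (h1.trans h4) h
  rw [edgeHeight, hL, ← edgeHeight, edgeHeight_right (hD.lt f hf)]

/-- Edges on the same line with overlapping interiors coincide. -/
lemma eq_of_edgeLine_eq (hD : IsDrawing P E) {e f : (ℝ × ℝ) × (ℝ × ℝ)} (he : e ∈ E)
    (hf : f ∈ E) (hL : edgeLine e = edgeLine f) {x : ℝ}
    (h1 : e.1.1 < x) (h2 : x < e.2.1) (h3 : f.1.1 < x) (h4 : x < f.2.1) : e = f := by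
  apply Prod.ext
  · exact hD.eq_of_fst_eq (hD.left_mem e he) (hD.left_mem f hf) (le_antisymm
      (hD.left_le_of_edgeLine_eq hf he hL.symm h4 h1) (hD.left_le_of_edgeLine_eq he hf hL h2 h3))
  · exact hD.eq_of_fst_eq (hD.right_mem e he) (hD.right_mem f hf) (le_antisymm
      (hD.right_le_of_edgeLine_eq he hf hL h1 h4) (hD.right_le_of_edgeLine_eq hf he hL.symm h3 h2))

lemma eq_of_left_eq (hD : IsDrawing P E) {e f : (ℝ × ℝ) × (ℝ × ℝ)} (he : e ∈ E)
    (hf : f ∈ E) (h : e.1 = f.1) (hs : (edgeLine e).1 = (edgeLine f).1) : e = f := by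
  have hL : edgeLine e = edgeLine f := by
    have h1 := edgeHeight_left e
    have h2 := edgeHeight_left f
    simp only [edgeHeight, hs, h] at h1 h2
    exact Prod.ext hs (by linarith)
  have hle := hD.lt e he
  have hlf := hD.lt f hf
  obtain ⟨x, hx1, hx2⟩ := exists_between (lt_min hle (by rwa [h] : e.1.1 < f.2.1))
  rw [lt_min_iff] at hx2
  exact hD.eq_of_edgeLine_eq he hf hL hx1 hx2.1 (by rwa [← h]) hx2.2

end IsDrawing

/-- The lower neighbour `e'` of `e` among the edges with the same left endpoint, together with the
first vertex `v` met when sweeping the wedge between them from left to right. -/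
structure IsWedge (P : Finset (ℝ × ℝ)) (E : Finset ((ℝ × ℝ) × (ℝ × ℝ)))
    (e e' : (ℝ × ℝ) × (ℝ × ℝ)) (v : ℝ × ℝ) : Prop where
  mem : e ∈ E
  mem' : e' ∈ E
  left_eq : e'.1 = e.1
  slope_lt : (edgeLine e').1 < (edgeLine e).1
  slope_le : ∀ f ∈ E, f.1 = e.1 → (edgeLine f).1 < (edgeLine e).1 →
    (edgeLine f).1 ≤ (edgeLine e').1
  vertex_mem : v ∈ P
  left_lt : e.1.1 < v.1
  le_right : v.1 ≤ e.2.1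
  le_right' : v.1 ≤ e'.2.1
  height_le : v.2 ≤ edgeHeight e v.1
  le_height : edgeHeight e' v.1 ≤ v.2
  first : ∀ w ∈ P, e.1.1 < w.1 → w.1 < v.1 → edgeHeight e' w.1 ≤ w.2 → edgeHeight e w.1 < w.2

namespace IsDrawing

variable {P : Finset (ℝ × ℝ)} {E : Finset ((ℝ × ℝ) × (ℝ × ℝ))}

lemma exists_isWedge (hD : IsDrawing P E) {e : (ℝ × ℝ) × (ℝ × ℝ)} (he : e ∈ E)
    (h : ∃ f ∈ E, f.1 = e.1 ∧ (edgeLine f).1 < (edgeLine e).1) :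
    ∃ e' v, IsWedge P E e e' v := by
  classical
  obtain ⟨e', he', hmax⟩ := Finset.exists_max_image
    (E.filter fun f => f.1 = e.1 ∧ (edgeLine f).1 < (edgeLine e).1) (fun f => (edgeLine f).1)
    (by obtain ⟨f, hf, h'⟩ := h; exact ⟨f, Finset.mem_filter.2 ⟨hf, h'⟩⟩)
  rw [Finset.mem_filter] at he'
  obtain ⟨he', hl, hs⟩ := he'
  have hcmp : ∀ x, e.1.1 ≤ x → edgeHeight e' x ≤ edgeHeight e x := by
    intro x hx
    rw [edgeHeight_eq_add, edgeHeight_eq_add, hl]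
    nlinarith
  have hlt := hD.lt e he
  have hlt' := hD.lt e' he'
  obtain ⟨v, hv, hmin⟩ := Finset.exists_min_image
    (P.filter fun w => e.1.1 < w.1 ∧ w.1 ≤ e.2.1 ∧ w.1 ≤ e'.2.1 ∧ w.2 ≤ edgeHeight e w.1 ∧
      edgeHeight e' w.1 ≤ w.2) (fun w => w.1) (by
        rcases le_total e.2.1 e'.2.1 with h1 | h1
        · refine ⟨e.2, Finset.mem_filter.2 ⟨hD.right_mem e he, hlt, le_rfl, h1, ?_, ?_⟩⟩
          · rw [edgeHeight_right hlt]
          · rw [← edgeHeight_right hlt]; exact hcmp _ hlt.le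
        · refine ⟨e'.2, Finset.mem_filter.2 ⟨hD.right_mem e' he', hl ▸ hlt', h1, le_rfl, ?_, ?_⟩⟩
          · rw [← edgeHeight_right hlt']; exact hcmp _ (hl ▸ hlt').le
          · rw [edgeHeight_right hlt'])
  rw [Finset.mem_filter] at hv
  obtain ⟨hvP, h1, h2, h3, h4, h5⟩ := hv
  refine ⟨e', v, he, he', hl, hs, fun f hf hfe hfs => hmax f (Finset.mem_filter.2 ⟨hf, hfe, hfs⟩),
    hvP, h1, h2, h3, h4, h5, fun w hw hw1 hw2 hw3 => ?_⟩
  by_contra! hw4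
  exact absurd (hmin w (Finset.mem_filter.2
    ⟨hw, hw1, by linarith, by linarith, hw4, hw3⟩)) (not_le.2 hw2)

/-- In a noncrossing drawing no edge passes through a wedge before its first vertex. -/
lemma false_of_isWedge (hD : IsDrawing P E) (hc : ∀ e ∈ E, ∀ f ∈ E, e ≠ f → ¬ Crosses e f)
    {e e' f : (ℝ × ℝ) × (ℝ × ℝ)} {v : ℝ × ℝ} (hW : IsWedge P E e e' v) (hf : f ∈ E) {x : ℝ}
    (hx1 : e.1.1 < x) (hx2 : x < v.1) (hfx1 : f.1.1 < x) (hfx2 : x < f.2.1)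
    (h1 : edgeHeight e' x < edgeHeight f x) (h2 : edgeHeight f x < edgeHeight e x) : False := by
  have hr := hW.le_right
  have hr' := hW.le_right'
  have hl : e'.1.1 = e.1.1 := by rw [hW.left_eq]
  have hce : ¬ Crosses e f := hc _ hW.mem _ hf (by rintro rfl; exact lt_irrefl _ h2)
  have hce' : ¬ Crosses f e' := hc _ hf _ hW.mem' (by rintro rfl; exact lt_irrefl _ h1)
  have upper : ∀ y, e.1.1 ≤ y → f.1.1 ≤ y → y ≤ x → edgeHeight f y ≤ edgeHeight e y := by
    intro y hy1 hy2 hy3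
    by_contra! h
    exact absurd (edgeHeight_lt_of_not_crosses hce hy1 (by linarith) hy2 (by linarith)
      hx1 (by linarith) hfx1 hfx2 h) (by linarith)
  have lower : ∀ y, e.1.1 ≤ y → f.1.1 ≤ y → y ≤ x → edgeHeight e' y ≤ edgeHeight f y := by
    intro y hy1 hy2 hy3
    by_contra! h
    exact absurd (edgeHeight_lt_of_not_crosses hce' hy2 (by linarith) (by linarith) (by linarith)
      hfx1 hfx2 (by linarith) (by linarith) h) (by linarith)
  rcases lt_trichotomy f.1.1 e.1.1 with h | h | h
  · refine hD.height_ne f hf e.1 (hD.left_mem e hW.mem) h (by linarith) (le_antisymm ?_ ?_)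
    · simpa [edgeHeight_left] using upper e.1.1 le_rfl h.le hx1.le
    · have h3 := lower e.1.1 le_rfl h.le hx1.le
      have h4 := edgeHeight_left e'
      rw [hW.left_eq] at h4
      rwa [h4] at h3
  · have hfe := hD.eq_of_fst_eq (hD.left_mem f hf) (hD.left_mem e hW.mem) h
    rw [edgeHeight_eq_add, edgeHeight_eq_add f, hW.left_eq, hfe] at h1
    rw [edgeHeight_eq_add, edgeHeight_eq_add e, hfe] at h2
    have hxp : 0 < x - e.1.1 := by linarith
    have h2' : (edgeLine f).1 < (edgeLine e).1 := by
      by_contra! hh; nlinarith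
    have h1' : (edgeLine e').1 < (edgeLine f).1 := by
      by_contra! hh; nlinarith
    exact absurd (hW.slope_le f hf hfe h2') (not_le.2 h1')
  · have hu := upper f.1.1 h.le le_rfl hfx1.le
    have hlo := lower f.1.1 h.le le_rfl hfx1.le
    rw [edgeHeight_left] at hu hlo
    exact absurd (hW.first f.1 (hD.left_mem f hf) h (by linarith) hlo) (not_lt.2 hu)

lemma false_of_isWedge_of_lt (hD : IsDrawing P E)
    (hc : ∀ e ∈ E, ∀ f ∈ E, e ≠ f → ¬ Crosses e f)
    {e e' f f' : (ℝ × ℝ) × (ℝ × ℝ)} {v : ℝ × ℝ} (he : IsWedge P E e e' v)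
    (hf : IsWedge P E f f' v) (hv : v = e.2 ↔ v = f.2) {x : ℝ} (hex : e.1.1 < x) (hfx : f.1.1 < x)
    (hxv : x < v.1) (hlt : edgeHeight e x < edgeHeight f x) : False := by
  have hvr := he.le_right
  have hvr' := hf.le_right'
  have key : edgeHeight f' v.1 < edgeHeight e v.1 := by
    by_cases h : v = e.2
    · have hvf := hv.1 h
      have hev : edgeHeight e v.1 = v.2 := by rw [h, edgeHeight_right (hD.lt e he.mem)]
      rw [hev]
      refine lt_of_le_of_ne hf.le_height fun heq => ?_
      rcases hvr'.lt_or_eq with h' | h'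
      · exact hD.height_ne f' hf.mem' v hf.vertex_mem (by rw [hf.left_eq]; exact hf.left_lt) h' heq
      · have h2 := hD.eq_of_fst_eq hf.vertex_mem (hD.right_mem f' hf.mem') h'
        have : f' = f := Prod.ext hf.left_eq (h2.symm.trans hvf)
        exact absurd hf.slope_lt (by rw [this]; exact lt_irrefl _)
    · have hlt' : v.1 < e.2.1 := lt_of_le_of_ne hvr fun h' =>
        h (hD.eq_of_fst_eq he.vertex_mem (hD.right_mem e he.mem) h')
      have := hD.height_ne e he.mem v he.vertex_mem he.left_lt hlt'
      exact hf.le_height.trans_lt (lt_of_le_of_ne he.height_le this.symm)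
  have hl : f'.1.1 = f.1.1 := by rw [hf.left_eq]
  have hce : ¬ Crosses f' e := hc _ hf.mem' _ he.mem (by rintro rfl; exact lt_irrefl _ key)
  exact hD.false_of_isWedge hc hf he.mem hfx hxv hex (by linarith)
    (edgeHeight_lt_of_not_crosses hce (by linarith) hvr' (by linarith) hvr (by linarith)
      (by linarith) hex (by linarith) key) hlt

/-- A noncrossing straight-line drawing on `n` vertices has at most `3 * n` edges. -/
theorem card_le_of_not_crosses (hD : IsDrawing P E)
    (hc : ∀ e ∈ E, ∀ f ∈ E, e ≠ f → ¬ Crosses e f) : E.card ≤ 3 * P.card := by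
  classical
  let B : (ℝ × ℝ) × (ℝ × ℝ) → Prop := fun e =>
    ∃ f ∈ E, f.1 = e.1 ∧ (edgeLine f).1 < (edgeLine e).1
  have h0 : (E.filter fun e => ¬ B e).card ≤ P.card := by
    refine Finset.card_le_card_of_injOn Prod.fst
      (fun e he => hD.left_mem e (Finset.mem_filter.1 he).1) ?_
    intro e he f hf hef
    obtain ⟨he, heB⟩ := Finset.mem_filter.1 (Finset.mem_coe.1 he)
    obtain ⟨hf, hfB⟩ := Finset.mem_filter.1 (Finset.mem_coe.1 hf)
    refine hD.eq_of_left_eq he hf hef (le_antisymm ?_ ?_)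
    · by_contra! h; exact heB ⟨f, hf, hef.symm, h⟩
    · by_contra! h; exact hfB ⟨e, he, hef, h⟩
  have h1 : (E.filter B).card ≤ 2 * P.card := by
    have hw : ∀ e, ∃ e' v, e ∈ E.filter B → IsWedge P E e e' v := by
      intro e
      by_cases h : e ∈ E.filter B
      · obtain ⟨e', v, hW⟩ := hD.exists_isWedge (Finset.mem_filter.1 h).1 (Finset.mem_filter.1 h).2
        exact ⟨e', v, fun _ => hW⟩
      · exact ⟨e, e.1, fun h' => absurd h' h⟩
    choose l v hW using hw
    have : (E.filter B).card ≤ (P ×ˢ (Finset.univ : Finset Bool)).card := by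
      refine Finset.card_le_card_of_injOn (fun e => (v e, decide (v e = e.2)))
        (fun e he => Finset.mem_product.2 ⟨(hW e he).vertex_mem, Finset.mem_univ _⟩) ?_
      intro e he f hf hef
      simp only [Prod.mk.injEq, decide_eq_decide] at hef
      obtain ⟨hv, hiff⟩ := hef
      have hWe := hW e he
      have hWf := hW f hf
      rw [hv] at hWe hiff
      by_contra hne
      obtain ⟨x, hx1, hx2⟩ := exists_between (max_lt hWe.left_lt hWf.left_lt)
      rw [max_lt_iff] at hx1
      rcases lt_trichotomy (edgeHeight e x) (edgeHeight f x) with h | h | h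
      · exact hD.false_of_isWedge_of_lt hc hWe hWf hiff hx1.1 hx1.2 hx2 h
      · exact hc e hWe.mem f hWf.mem hne ⟨x, hx1.1, hx2.trans_le hWe.le_right, hx1.2,
          hx2.trans_le hWf.le_right, h⟩
      · exact hD.false_of_isWedge_of_lt hc hWf hWe hiff.symm hx1.2 hx1.1 hx2 h
    simp [Finset.card_product] at this
    omega
  have := Finset.card_filter_add_card_filter_not (s := E) B
  omega

end IsDrawing

section Sampling

variable {α ι : Type*} [DecidableEq α]

/-- The probability that a random subset of `P`, containing each element independently with
probability `p`, equals `S`. -/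
def sampleWeight (p : ℝ) (P S : Finset α) : ℝ :=
  p ^ S.card * (1 - p) ^ (P \ S).card

lemma sampleWeight_nonneg {p : ℝ} (h0 : 0 ≤ p) (h1 : p ≤ 1) (P S : Finset α) :
    0 ≤ sampleWeight p P S :=
  mul_nonneg (pow_nonneg h0 _) (pow_nonneg (by linarith) _)

lemma sum_sampleWeight_of_subset (p : ℝ) {P A : Finset α} (hA : A ⊆ P) :
    ∑ S ∈ P.powerset, (if A ⊆ S then sampleWeight p P S else 0) = p ^ A.card := by
  have h := Finset.prod_add (fun _ : α => p) (fun a => if a ∈ A then 0 else 1 - p) P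
  have hl : ∏ a ∈ P, (p + if a ∈ A then 0 else 1 - p) = p ^ A.card := by
    rw [← Finset.prod_subset hA (fun a _ ha => by simp [ha])]
    rw [Finset.prod_congr rfl (fun a ha => by rw [if_pos ha, add_zero]), Finset.prod_const]
  rw [← hl, h]
  refine Finset.sum_congr rfl fun S _ => ?_
  split_ifs with hS
  · rw [sampleWeight, Finset.prod_const]
    congr 1
    rw [← Finset.prod_const]
    exact Finset.prod_congr rfl fun a ha => by
      rw [if_neg fun h' => (Finset.mem_sdiff.1 ha).2 (hS h')]
  · obtain ⟨a, haA, haS⟩ := Finset.not_subset.1 hS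
    rw [Finset.prod_eq_zero (Finset.mem_sdiff.2 ⟨hA haA, haS⟩) (by simp [haA]), mul_zero]

lemma sum_sampleWeight_mul_card (p : ℝ) {P : Finset α} (I : Finset ι) (A : ι → Finset α) (k : ℕ)
    (hA : ∀ i ∈ I, A i ⊆ P) (hk : ∀ i ∈ I, (A i).card = k) :
    ∑ S ∈ P.powerset, sampleWeight p P S * ((I.filter fun i => A i ⊆ S).card : ℝ) =
      p ^ k * I.card := by
  have : ∀ S ∈ P.powerset, sampleWeight p P S * ((I.filter fun i => A i ⊆ S).card : ℝ) =
      ∑ i ∈ I, if A i ⊆ S then sampleWeight p P S else 0 := by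
    intro S _
    rw [← Finset.sum_filter, Finset.sum_const, nsmul_eq_mul, mul_comm]
  rw [Finset.sum_congr rfl this, Finset.sum_comm, Finset.sum_congr rfl fun i hi => by
    rw [sum_sampleWeight_of_subset p (hA i hi), hk i hi], Finset.sum_const, nsmul_eq_mul, mul_comm]

lemma sum_sampleWeight_mul_card_self (p : ℝ) (P : Finset α) :
    ∑ S ∈ P.powerset, sampleWeight p P S * (S.card : ℝ) = p * P.card := by
  have h := sum_sampleWeight_mul_card p P (fun a => {a}) 1
    (fun a ha => Finset.singleton_subset_iff.2 ha) (fun a _ => Finset.card_singleton a)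
  rw [pow_one] at h
  rw [← h]
  refine Finset.sum_congr rfl fun S hS => ?_
  simp only [Finset.singleton_subset_iff]
  rw [Finset.filter_mem_eq_inter, Finset.inter_eq_right.2 (Finset.mem_powerset.1 hS)]

end Sampling

namespace IsDrawing

variable {P : Finset (ℝ × ℝ)} {E : Finset ((ℝ × ℝ) × (ℝ × ℝ))}

open scoped Classical in
/-- The ordered pairs of distinct crossing edges. -/
noncomputable def crossings (E : Finset ((ℝ × ℝ) × (ℝ × ℝ))) :
    Finset (((ℝ × ℝ) × (ℝ × ℝ)) × ((ℝ × ℝ) × (ℝ × ℝ))) :=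
  (E ×ˢ E).filter fun x => x.1 ≠ x.2 ∧ Crosses x.1 x.2

lemma mem_crossings {x : ((ℝ × ℝ) × (ℝ × ℝ)) × ((ℝ × ℝ) × (ℝ × ℝ))} :
    x ∈ crossings E ↔ (x.1 ∈ E ∧ x.2 ∈ E) ∧ x.1 ≠ x.2 ∧ Crosses x.1 x.2 := by
  classical
  rw [crossings, Finset.mem_filter, Finset.mem_product]

lemma card_le_add_crossings (hD : IsDrawing P E) :
    E.card ≤ 3 * P.card + (crossings E).card := by
  classical
  have hD' : IsDrawing P (E \ (crossings E).image Prod.fst) :=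
    hD.mono subset_rfl Finset.sdiff_subset
      (fun e he => hD.left_mem e (Finset.mem_sdiff.1 he).1)
      (fun e he => hD.right_mem e (Finset.mem_sdiff.1 he).1)
  have h1 := hD'.card_le_of_not_crosses fun e he f hf hne hc =>
    (Finset.mem_sdiff.1 he).2 (Finset.mem_image.2 ⟨(e, f), mem_crossings.2
      ⟨⟨(Finset.mem_sdiff.1 he).1, (Finset.mem_sdiff.1 hf).1⟩, hne, hc⟩, rfl⟩)
  have h2 := Finset.le_card_sdiff ((crossings E).image Prod.fst) E
  have h3 : ((crossings E).image Prod.fst).card ≤ (crossings E).card := Finset.card_image_le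
  omega

lemma edgeLine_ne (hD : IsDrawing P E) {e f : (ℝ × ℝ) × (ℝ × ℝ)} (he : e ∈ E) (hf : f ∈ E)
    (hne : e ≠ f) (hc : Crosses e f) : edgeLine e ≠ edgeLine f := by
  obtain ⟨x, h1, h2, h3, h4, -⟩ := hc
  exact fun h => hne (hD.eq_of_edgeLine_eq he hf h h1 h2 h3 h4)

lemma eq_of_edgeHeight_eq {e f : (ℝ × ℝ) × (ℝ × ℝ)} (hne : edgeLine e ≠ edgeLine f) {x y : ℝ}
    (hx : edgeHeight e x = edgeHeight f x) (hy : edgeHeight e y = edgeHeight f y) : x = y := by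
  by_contra hxy
  simp only [edgeHeight] at hx hy
  have h : ((edgeLine e).1 - (edgeLine f).1) * (x - y) = 0 := by linarith
  have hs : (edgeLine e).1 = (edgeLine f).1 := by
    rcases mul_eq_zero.1 h with h | h
    · linarith
    · exact absurd (by linarith) hxy
  exact hne (Prod.ext hs (by rw [hs] at hx; linarith))

lemma card_endpoints (hD : IsDrawing P E) {e f : (ℝ × ℝ) × (ℝ × ℝ)} (he : e ∈ E) (hf : f ∈ E)
    (hne : e ≠ f) (hc : Crosses e f) :
    ({e.1, e.2, f.1, f.2} : Finset (ℝ × ℝ)).card = 4 := by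
  have hL := hD.edgeLine_ne he hf hne hc
  obtain ⟨x, h1, h2, h3, h4, h5⟩ := hc
  have hlt := hD.lt e he
  have hlt' := hD.lt f hf
  have a1 : e.1 ≠ e.2 := fun h => by rw [h] at hlt; exact lt_irrefl _ hlt
  have a2 : f.1 ≠ f.2 := fun h => by rw [h] at hlt'; exact lt_irrefl _ hlt'
  have a3 : e.1 ≠ f.2 := fun h => by rw [h] at h1; linarith
  have a4 : e.2 ≠ f.1 := fun h => by rw [h] at h2; linarith
  have a5 : e.1 ≠ f.1 := fun h => by
    have h6 := edgeHeight_left e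
    rw [h, ← edgeHeight_left f] at h6
    exact h3.ne (eq_of_edgeHeight_eq hL h6 h5)
  have a6 : e.2 ≠ f.2 := fun h => by
    have h6 := edgeHeight_right hlt
    rw [h, ← edgeHeight_right hlt'] at h6
    exact h4.ne' (eq_of_edgeHeight_eq hL h6 h5)
  rw [Finset.card_insert_of_notMem (by simp [a1, a5, a3]),
    Finset.card_insert_of_notMem (by simp [a4, a6]), Finset.card_pair a2]

lemma card_crossings_le (hD : IsDrawing P E) {𝓛 : Finset (ℝ × ℝ)}
    (h𝓛 : ∀ e ∈ E, edgeLine e ∈ 𝓛) : (crossings E).card ≤ 𝓛.card ^ 2 := by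
  rw [sq, ← Finset.card_product]
  refine Finset.card_le_card_of_injOn (fun x => (edgeLine x.1, edgeLine x.2)) ?_ ?_
  · intro x hx
    obtain ⟨⟨h1, h2⟩, -⟩ := mem_crossings.1 hx
    exact Finset.mem_product.2 ⟨h𝓛 _ h1, h𝓛 _ h2⟩
  · rintro ⟨e, f⟩ hx ⟨e', f'⟩ hy hxy
    obtain ⟨⟨he, hf⟩, hne, hc⟩ := mem_crossings.1 hx
    obtain ⟨⟨he', hf'⟩, -, y, k1, k2, k3, k4, k5⟩ := mem_crossings.1 hy
    obtain ⟨hee, hff⟩ := Prod.mk.injEq .. ▸ hxy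
    have hL := hD.edgeLine_ne he hf hne hc
    obtain ⟨x, h1, h2, h3, h4, h5⟩ := hc
    dsimp only at *
    have hy' : edgeHeight e y = edgeHeight f y := by
      simpa only [edgeHeight, hee, hff] using k5
    obtain rfl := eq_of_edgeHeight_eq hL h5 hy'
    rw [hD.eq_of_edgeLine_eq he he' hee h1 h2 k1 k2, hD.eq_of_edgeLine_eq hf hf' hff h3 h4 k3 k4]

lemma sample_inequality (hD : IsDrawing P E) {p : ℝ} (h0 : 0 ≤ p) (h1 : p ≤ 1) :
    p ^ 2 * E.card ≤ 3 * (p * P.card) + p ^ 4 * (crossings E).card := by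
  classical
  have hE := sum_sampleWeight_mul_card p (P := P) E (fun e => {e.1, e.2}) 2
    (fun e he => by
      simp [Finset.insert_subset_iff, hD.left_mem e he, hD.right_mem e he])
    (fun e he => Finset.card_pair fun h => (hD.lt e he).ne (by rw [h]))
  have hX := sum_sampleWeight_mul_card p (P := P) (crossings E)
    (fun x => {x.1.1, x.1.2, x.2.1, x.2.2}) 4
    (fun x hx => by
      obtain ⟨⟨he, hf⟩, -⟩ := mem_crossings.1 hx
      simp [Finset.insert_subset_iff, hD.left_mem _ he, hD.right_mem _ he, hD.left_mem _ hf,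
        hD.right_mem _ hf])
    (fun x hx => by
      obtain ⟨⟨he, hf⟩, hne, hc⟩ := mem_crossings.1 hx
      exact hD.card_endpoints he hf hne hc)
  rw [← hE, ← hX, ← sum_sampleWeight_mul_card_self p P, Finset.mul_sum, ← Finset.sum_add_distrib]
  refine Finset.sum_le_sum fun S hS => ?_
  have hD' : IsDrawing S (E.filter fun e => {e.1, e.2} ⊆ S) :=
    hD.mono (Finset.mem_powerset.1 hS) (Finset.filter_subset _ _)
      (fun e he => (Finset.mem_filter.1 he).2 (by simp))
      (fun e he => (Finset.mem_filter.1 he).2 (by simp))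
  have h2 : (crossings (E.filter fun e => {e.1, e.2} ⊆ S)) ⊆
      (crossings E).filter fun x => {x.1.1, x.1.2, x.2.1, x.2.2} ⊆ S := by
    intro x hx
    obtain ⟨⟨he, hf⟩, hne, hc⟩ := mem_crossings.1 hx
    rw [Finset.mem_filter] at he hf
    refine Finset.mem_filter.2 ⟨mem_crossings.2 ⟨⟨he.1, hf.1⟩, hne, hc⟩, ?_⟩
    have h3 := he.2
    have h4 := hf.2
    simp only [Finset.insert_subset_iff, Finset.singleton_subset_iff] at h3 h4 ⊢
    exact ⟨h3.1, h3.2, h4.1, h4.2⟩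
  have h3 := hD'.card_le_add_crossings.trans (Nat.add_le_add_left (Finset.card_le_card h2) _)
  have h4 : ((E.filter fun e => {e.1, e.2} ⊆ S).card : ℝ) ≤ 3 * S.card +
      (((crossings E).filter fun x => {x.1.1, x.1.2, x.2.1, x.2.2} ⊆ S).card : ℝ) := by
    exact_mod_cast h3
  have h5 := mul_le_mul_of_nonneg_left h4 (sampleWeight_nonneg h0 h1 P S)
  linarith

/-- The crossing lemma. -/
theorem card_pow_three_le (hD : IsDrawing P E) (h : 6 * P.card ≤ E.card) :
    (E.card : ℝ) ^ 3 ≤ 72 * (P.card : ℝ) ^ 2 * (crossings E).card := by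
  have hN : (0 : ℝ) ≤ P.card := Nat.cast_nonneg _
  have hX : (0 : ℝ) ≤ (crossings E).card := Nat.cast_nonneg _
  rcases Nat.eq_zero_or_pos E.card with hE0 | hE0
  · rw [hE0]; simp; positivity
  have hE : (0 : ℝ) < E.card := by exact_mod_cast hE0
  have hP : (0 : ℝ) < P.card := by
    obtain ⟨e, he⟩ := Finset.card_pos.1 hE0
    exact_mod_cast Finset.card_pos.2 ⟨_, hD.left_mem e he⟩
  have h6 : (6 : ℝ) * P.card ≤ E.card := by exact_mod_cast h
  have hp0 : (0 : ℝ) < 6 * P.card / E.card := by positivity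
  have key := hD.sample_inequality hp0.le ((div_le_one hE).2 h6)
  generalize (crossings E).card = X at *
  generalize (E.card : ℝ) = e at *
  generalize (P.card : ℝ) = n at *
  have h7 : (6 * n / e) ^ 2 * e = 36 * n ^ 2 / e := by field_simp; ring
  have h8 : 3 * (6 * n / e * n) = 18 * n ^ 2 / e := by ring
  have h9 : (6 * n / e) ^ 4 * X = 1296 * n ^ 4 * X / e ^ 4 := by ring
  rw [h7, h8, h9] at key
  have h10 : 18 * n ^ 2 / e ≤ 1296 * n ^ 4 * X / e ^ 4 := by
    have : 36 * n ^ 2 / e = 2 * (18 * n ^ 2 / e) := by ring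
    linarith
  rw [div_le_div_iff₀ hE (by positivity)] at h10
  have h11 : (18 * n ^ 2 * e) * e ^ 3 ≤ (18 * n ^ 2 * e) * (72 * n ^ 2 * X) := by linarith
  exact le_of_mul_le_mul_left h11 (by positivity)

end IsDrawing

/-- The points of `P` on the line `y = L.1 * x + L.2`. -/
noncomputable def onLine (P : Finset (ℝ × ℝ)) (L : ℝ × ℝ) : Finset (ℝ × ℝ) :=
  P.filter fun q => q.2 = L.1 * q.1 + L.2

lemma mem_onLine {P : Finset (ℝ × ℝ)} {L q : ℝ × ℝ} :
    q ∈ onLine P L ↔ q ∈ P ∧ q.2 = L.1 * q.1 + L.2 :=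
  Finset.mem_filter

open scoped Classical in
/-- The segments between consecutive points of `P` on the lines in `𝓛`. -/
noncomputable def consecutiveEdges (P 𝓛 : Finset (ℝ × ℝ)) : Finset ((ℝ × ℝ) × (ℝ × ℝ)) :=
  (P ×ˢ P).filter fun e => e.1.1 < e.2.1 ∧ edgeLine e ∈ 𝓛 ∧
    ∀ v ∈ P, e.1.1 < v.1 → v.1 < e.2.1 → edgeHeight e v.1 ≠ v.2

lemma mem_consecutiveEdges {P 𝓛 : Finset (ℝ × ℝ)} {e : (ℝ × ℝ) × (ℝ × ℝ)} :
    e ∈ consecutiveEdges P 𝓛 ↔ (e.1 ∈ P ∧ e.2 ∈ P) ∧ e.1.1 < e.2.1 ∧ edgeLine e ∈ 𝓛 ∧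
      ∀ v ∈ P, e.1.1 < v.1 → v.1 < e.2.1 → edgeHeight e v.1 ≠ v.2 := by
  classical
  rw [consecutiveEdges, Finset.mem_filter, Finset.mem_product]

lemma isDrawing_consecutiveEdges {P : Finset (ℝ × ℝ)}
    (hP : Set.InjOn Prod.fst (P : Set (ℝ × ℝ))) (𝓛 : Finset (ℝ × ℝ)) :
    IsDrawing P (consecutiveEdges P 𝓛) where
  inj := hP
  left_mem _ he := (mem_consecutiveEdges.1 he).1.1
  right_mem _ he := (mem_consecutiveEdges.1 he).1.2
  lt _ he := (mem_consecutiveEdges.1 he).2.1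
  height_ne _ he := (mem_consecutiveEdges.1 he).2.2.2

lemma exists_consecutiveEdge {P : Finset (ℝ × ℝ)} {𝓛 : Finset (ℝ × ℝ)} {L p q : ℝ × ℝ}
    (hL : L ∈ 𝓛) (hp : p ∈ onLine P L) (hq : q ∈ onLine P L) (hpq : p.1 < q.1) :
    ∃ r, (p, r) ∈ consecutiveEdges P 𝓛 ∧ edgeLine (p, r) = L := by
  obtain ⟨r, hr, hmin⟩ := Finset.exists_min_image ((onLine P L).filter fun r => p.1 < r.1)
    Prod.fst ⟨q, Finset.mem_filter.2 ⟨hq, hpq⟩⟩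
  obtain ⟨hr, hpr⟩ := Finset.mem_filter.1 hr
  rw [mem_onLine] at hp hr
  have hline : edgeLine (p, r) = L := edgeLine_eq hpr hp.2 hr.2
  refine ⟨r, mem_consecutiveEdges.2 ⟨⟨hp.1, hr.1⟩, hpr, hline ▸ hL, ?_⟩, hline⟩
  intro v hv h1 h2 h3
  rw [edgeHeight, hline] at h3
  exact absurd (hmin v (Finset.mem_filter.2 ⟨mem_onLine.2 ⟨hv, h3.symm⟩, h1⟩)) (not_le.2 h2)

lemma card_onLine_le {P : Finset (ℝ × ℝ)} (hP : Set.InjOn Prod.fst (P : Set (ℝ × ℝ)))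
    {𝓛 : Finset (ℝ × ℝ)} {L : ℝ × ℝ} (hL : L ∈ 𝓛) :
    (onLine P L).card ≤ ((consecutiveEdges P 𝓛).filter fun e => edgeLine e = L).card + 1 := by
  classical
  rcases (onLine P L).eq_empty_or_nonempty with h | h
  · simp [h]
  obtain ⟨m, hm, hmax⟩ := Finset.exists_max_image (onLine P L) Prod.fst h
  rw [← Finset.card_erase_add_one hm]
  refine Nat.add_le_add_right ((Finset.card_le_card ?_).trans
    (Finset.card_image_le (f := Prod.fst))) 1
  intro p hp
  obtain ⟨hpm, hp⟩ := Finset.mem_erase.1 hp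
  obtain ⟨r, hr, hline⟩ := exists_consecutiveEdge hL hp hm (lt_of_le_of_ne (hmax p hp) fun h' =>
    hpm (hP (mem_onLine.1 hp).1 (mem_onLine.1 hm).1 h'))
  exact Finset.mem_image.2 ⟨(p, r), Finset.mem_filter.2 ⟨hr, hline⟩, rfl⟩

/-- The Szemerédi–Trotter bound on the number of lines with more than `k` points. -/
theorem card_rich_lines_le {P : Finset (ℝ × ℝ)} (hP : Set.InjOn Prod.fst (P : Set (ℝ × ℝ)))
    {𝓛 : Finset (ℝ × ℝ)} {k : ℕ} (hk : 0 < k) (h : ∀ L ∈ 𝓛, k < (onLine P L).card) :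
    (𝓛.card : ℝ) ≤ 6 * P.card / k + 72 * (P.card : ℝ) ^ 2 / k ^ 3 := by
  classical
  have hD := isDrawing_consecutiveEdges hP 𝓛
  have hmaps : ∀ e ∈ consecutiveEdges P 𝓛, edgeLine e ∈ 𝓛 :=
    fun e he => (mem_consecutiveEdges.1 he).2.2.1
  have hX := hD.card_crossings_le hmaps
  have hE : 𝓛.card * k ≤ (consecutiveEdges P 𝓛).card := by
    rw [Finset.card_eq_sum_card_fiberwise hmaps, ← smul_eq_mul]
    refine Finset.card_nsmul_le_sum _ _ _ fun L hL => ?_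
    have h1 := card_onLine_le hP hL
    have h2 := h L hL
    omega
  have hk' : (0 : ℝ) < k := by exact_mod_cast hk
  have hE' : (𝓛.card : ℝ) * k ≤ (consecutiveEdges P 𝓛).card := by exact_mod_cast hE
  rcases le_total (consecutiveEdges P 𝓛).card (6 * P.card) with hc | hc
  · have hc' : ((consecutiveEdges P 𝓛).card : ℝ) ≤ 6 * P.card := by exact_mod_cast hc
    have h1 : (𝓛.card : ℝ) ≤ 6 * P.card / k := by
      rw [le_div_iff₀ hk']; linarith
    have h2 : (0 : ℝ) ≤ 72 * (P.card : ℝ) ^ 2 / k ^ 3 := by positivity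
    linarith
  · have h1 := hD.card_pow_three_le hc
    have hX' : ((IsDrawing.crossings (consecutiveEdges P 𝓛)).card : ℝ) ≤ (𝓛.card : ℝ) ^ 2 := by
      exact_mod_cast hX
    have h2 : ((𝓛.card : ℝ) * k) ^ 3 ≤ 72 * (P.card : ℝ) ^ 2 * (𝓛.card : ℝ) ^ 2 :=
      (pow_le_pow_left₀ (by positivity) hE' 3).trans
        (h1.trans (mul_le_mul_of_nonneg_left hX' (by positivity)))
    have h3 : (0 : ℝ) ≤ 6 * P.card / k := by positivity
    rcases Nat.eq_zero_or_pos 𝓛.card with h0 | h0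
    · rw [h0, Nat.cast_zero]; positivity
    have h0' : (0 : ℝ) < 𝓛.card := by exact_mod_cast h0
    have h4 : (𝓛.card : ℝ) ≤ 72 * (P.card : ℝ) ^ 2 / k ^ 3 := by
      rw [le_div_iff₀ (by positivity)]
      refine le_of_mul_le_mul_left (a := (𝓛.card : ℝ) ^ 2) ?_ (by positivity)
      linarith
    linarith

/-- The lines spanned by pairs of points of `P`. -/
noncomputable def spannedLines (P : Finset (ℝ × ℝ)) : Finset (ℝ × ℝ) :=
  ((P ×ˢ P).filter fun e => e.1.1 < e.2.1).image edgeLine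

open scoped Classical in
/-- The collinear triples of points of `P`. -/
noncomputable def collinearTriples (P : Finset (ℝ × ℝ)) : Finset (Finset (ℝ × ℝ)) :=
  (P.powersetCard 3).filter fun T => Collinear ℝ (T : Set (ℝ × ℝ))

lemma mem_collinearTriples {P T : Finset (ℝ × ℝ)} :
    T ∈ collinearTriples P ↔ (T ⊆ P ∧ T.card = 3) ∧ Collinear ℝ (T : Set (ℝ × ℝ)) := by
  classical
  rw [collinearTriples, Finset.mem_filter, Finset.mem_powersetCard]

lemma collinear_onLine (P : Finset (ℝ × ℝ)) (L : ℝ × ℝ) :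
    Collinear ℝ (onLine P L : Set (ℝ × ℝ)) := by
  rw [collinear_iff_exists_forall_eq_smul_vadd]
  refine ⟨(0, L.2), (1, L.1), fun q hq => ⟨q.1, ?_⟩⟩
  have := (mem_onLine.1 (Finset.mem_coe.1 hq)).2
  ext
  · simp
  · simp [this, mul_comm]

lemma exists_subset_onLine {P T : Finset (ℝ × ℝ)} (hP : Set.InjOn Prod.fst (P : Set (ℝ × ℝ)))
    (hT : T ⊆ P) (hcard : 1 < T.card) (hc : Collinear ℝ (T : Set (ℝ × ℝ))) :
    ∃ L ∈ spannedLines P, T ⊆ onLine P L := by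
  obtain ⟨a, ha, b, hb, hab⟩ : ∃ a ∈ T, ∃ b ∈ T, a.1 < b.1 := by
    obtain ⟨a, ha, b, hb, hab⟩ := Finset.one_lt_card.1 hcard
    rcases lt_trichotomy a.1 b.1 with h | h | h
    · exact ⟨a, ha, b, hb, h⟩
    · exact absurd (hP (hT ha) (hT hb) h) hab
    · exact ⟨b, hb, a, ha, h⟩
  refine ⟨edgeLine (a, b), Finset.mem_image_of_mem _ (Finset.mem_filter.2
    ⟨Finset.mem_product.2 ⟨hT ha, hT hb⟩, hab⟩), fun c hcT => mem_onLine.2 ⟨hT hcT, ?_⟩⟩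
  obtain ⟨p, v, h⟩ := (collinear_iff_exists_forall_eq_smul_vadd (k := ℝ) _).1 hc
  obtain ⟨r, hr⟩ := h a ha
  obtain ⟨s, hs⟩ := h b hb
  obtain ⟨t, ht⟩ := h c hcT
  have hne : b.1 - a.1 ≠ 0 := by linarith
  change c.2 = edgeHeight (a, b) c.1
  rw [edgeHeight_eq_add, edgeLine]
  dsimp only
  rw [← sub_eq_iff_eq_add', div_mul_eq_mul_div, eq_div_iff hne]
  simp only [hr, hs, ht, Prod.fst_add, Prod.snd_add, Prod.smul_fst, Prod.smul_snd, vadd_eq_add,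
    smul_eq_mul]
  ring

lemma choose_three_le_sum (m : ℕ) :
    (m.choose 3 : ℝ) ≤ ∑ j ∈ Finset.range m, (j : ℝ) ^ 2 / 2 := by
  induction m with
  | zero => simp
  | succ m ih =>
    rw [Finset.sum_range_succ, Nat.choose_succ_succ' m 2, Nat.cast_add]
    have := Nat.choose_le_pow_div (α := ℝ) 2 m
    norm_num at this
    linarith

lemma sum_range_inv_le (l : ℕ) : ∑ j ∈ Finset.range l, ((j : ℝ))⁻¹ ≤ 1 + Real.log l := by
  cases l with
  | zero => simp
  | succ l =>
    rw [Finset.sum_range_succ']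
    have h := harmonic_le_one_add_log l
    rw [harmonic] at h
    push_cast at h ⊢
    have h2 : Real.log l ≤ Real.log (l + 1) := by
      rcases Nat.eq_zero_or_pos l with rfl | hl
      · simp
      · exact Real.log_le_log (by exact_mod_cast hl) (by linarith)
    simp only [inv_zero, add_zero]
    linarith

theorem card_collinearTriples_le {P : Finset (ℝ × ℝ)} (hP : Set.InjOn Prod.fst (P : Set (ℝ × ℝ)))
    {l : ℕ} (hl : AtMostCollinear P l) :
    ((collinearTriples P).card : ℝ) ≤
      3 * P.card * (l : ℝ) ^ 2 + 36 * (P.card : ℝ) ^ 2 * (1 + Real.log l) := by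
  classical
  have hm : ∀ L, (onLine P L).card ≤ l := fun L =>
    hl _ (Finset.filter_subset _ _) (collinear_onLine P L)
  have h1 : (collinearTriples P).card ≤ ∑ L ∈ spannedLines P, (onLine P L).card.choose 3 := by
    have hsub : collinearTriples P ⊆
        (spannedLines P).biUnion fun L => (onLine P L).powersetCard 3 := by
      intro T hT
      obtain ⟨⟨hTP, hT3⟩, hc⟩ := mem_collinearTriples.1 hT
      obtain ⟨L, hL, hTL⟩ := exists_subset_onLine hP hTP (by omega) hc
      exact Finset.mem_biUnion.2 ⟨L, hL, Finset.mem_powersetCard.2 ⟨hTL, hT3⟩⟩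
    refine (Finset.card_le_card hsub).trans (Finset.card_biUnion_le.trans ?_)
    simp [Finset.card_powersetCard]
  have h2 : ∀ L ∈ spannedLines P, ((onLine P L).card.choose 3 : ℝ) ≤
      ∑ j ∈ Finset.range l, if j < (onLine P L).card then (j : ℝ) ^ 2 / 2 else 0 := by
    intro L _
    refine (choose_three_le_sum _).trans (le_of_eq ?_)
    rw [← Finset.sum_filter]
    refine Finset.sum_congr (Finset.ext fun j => ?_) fun _ _ => rfl
    have := hm L
    simp only [Finset.mem_range, Finset.mem_filter]
    omega
  have h3 : ∀ j ∈ Finset.range l, (∑ L ∈ spannedLines P,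
      if j < (onLine P L).card then (j : ℝ) ^ 2 / 2 else 0) ≤
      3 * P.card * l + 36 * (P.card : ℝ) ^ 2 * (j : ℝ)⁻¹ := by
    intro j hj
    rw [← Finset.sum_filter, Finset.sum_const, nsmul_eq_mul]
    rcases Nat.eq_zero_or_pos j with rfl | hj0
    · simp; positivity
    have hj' : (0 : ℝ) < j := by exact_mod_cast hj0
    have hjl : (j : ℝ) ≤ l := by exact_mod_cast (Finset.mem_range.1 hj).le
    have h4 := card_rich_lines_le hP (𝓛 := (spannedLines P).filter fun L => j < (onLine P L).card)
      hj0 fun L hL => (Finset.mem_filter.1 hL).2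
    refine (mul_le_mul_of_nonneg_right h4 (by positivity)).trans ?_
    have h5 : (6 * (P.card : ℝ) / j + 72 * (P.card : ℝ) ^ 2 / j ^ 3) * ((j : ℝ) ^ 2 / 2) =
        3 * P.card * j + 36 * (P.card : ℝ) ^ 2 * (j : ℝ)⁻¹ := by
      field_simp
      ring
    rw [h5]
    gcongr
  calc ((collinearTriples P).card : ℝ)
      ≤ ∑ L ∈ spannedLines P, ((onLine P L).card.choose 3 : ℝ) := by exact_mod_cast h1
    _ ≤ ∑ L ∈ spannedLines P, ∑ j ∈ Finset.range l,
          if j < (onLine P L).card then (j : ℝ) ^ 2 / 2 else 0 := Finset.sum_le_sum h2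
    _ = ∑ j ∈ Finset.range l, ∑ L ∈ spannedLines P,
          if j < (onLine P L).card then (j : ℝ) ^ 2 / 2 else 0 := Finset.sum_comm
    _ ≤ ∑ j ∈ Finset.range l, (3 * P.card * l + 36 * (P.card : ℝ) ^ 2 * (j : ℝ)⁻¹) :=
          Finset.sum_le_sum h3
    _ = 3 * P.card * (l : ℝ) ^ 2 +
          36 * (P.card : ℝ) ^ 2 * ∑ j ∈ Finset.range l, (j : ℝ)⁻¹ := by
          rw [Finset.sum_add_distrib, Finset.sum_const, Finset.card_range, nsmul_eq_mul,
            Finset.mul_sum]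
          ring
    _ ≤ _ := by
          gcongr
          exact sum_range_inv_le l

/-- Deleting a point from each collinear triple of a random sample of `P`. -/
theorem exists_generalPosition_of_card_collinearTriples (P : Finset (ℝ × ℝ)) {p : ℝ} (h0 : 0 ≤ p)
    (h1 : p ≤ 1) : ∃ S ⊆ P, GeneralPosition S ∧
      p * P.card - p ^ 3 * (collinearTriples P).card ≤ S.card := by
  classical
  have hT := sum_sampleWeight_mul_card p (P := P) (collinearTriples P) id 3
    (fun T hT => (mem_collinearTriples.1 hT).1.1) (fun T hT => (mem_collinearTriples.1 hT).1.2)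
  have hS := sum_sampleWeight_mul_card_self p P
  have hw : ∑ S ∈ P.powerset, sampleWeight p P S = 1 := by
    simpa using sum_sampleWeight_of_subset p (Finset.empty_subset P)
  obtain ⟨S, hSP, hle⟩ : ∃ S ∈ P.powerset, p * P.card - p ^ 3 * (collinearTriples P).card ≤
      (S.card : ℝ) - (((collinearTriples P).filter fun T => id T ⊆ S).card : ℝ) := by
    by_contra! hlt
    have h2 : ∀ S ∈ P.powerset, sampleWeight p P S * ((S.card : ℝ) -
        (((collinearTriples P).filter fun T => id T ⊆ S).card : ℝ)) ≤
        sampleWeight p P S * (p * P.card - p ^ 3 * (collinearTriples P).card) := fun S hS =>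
      mul_le_mul_of_nonneg_left (hlt S hS).le (sampleWeight_nonneg h0 h1 P S)
    obtain ⟨S, hS', hpos⟩ : ∃ S ∈ P.powerset, 0 < sampleWeight p P S := by
      by_contra! hn
      have := Finset.sum_nonpos hn
      linarith
    have h3 := Finset.sum_lt_sum h2 ⟨S, hS', mul_lt_mul_of_pos_left (hlt S hS') hpos⟩
    rw [← Finset.sum_mul, hw] at h3
    simp only [mul_sub, Finset.sum_sub_distrib] at h3
    rw [hT, hS] at h3
    linarith
  have hne : ∀ T : Finset (ℝ × ℝ), ∃ x, T.card = 3 → x ∈ T := by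
    intro T
    by_cases h : T.card = 3
    · obtain ⟨x, hx⟩ := Finset.card_pos.1 (by omega : 0 < T.card)
      exact ⟨x, fun _ => hx⟩
    · exact ⟨0, fun h' => absurd h' h⟩
  choose g hg using hne
  refine ⟨S \ ((collinearTriples P).filter fun T => id T ⊆ S).image g,
    Finset.sdiff_subset.trans (Finset.mem_powerset.1 hSP), ?_, ?_⟩
  · intro U hU hc
    by_contra! hcard
    obtain ⟨T, hTU, hT3⟩ := Finset.exists_subset_card_eq (by omega : 3 ≤ U.card)
    have hTS : T ⊆ S := (hTU.trans hU).trans Finset.sdiff_subset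
    have hTt : T ∈ collinearTriples P := mem_collinearTriples.2
      ⟨⟨hTS.trans (Finset.mem_powerset.1 hSP), hT3⟩, hc.subset (by exact_mod_cast hTU)⟩
    exact (Finset.mem_sdiff.1 (hU (hTU (hg T hT3)))).2
      (Finset.mem_image_of_mem g (Finset.mem_filter.2 ⟨hTt, hTS⟩))
  · have h4 := Finset.le_card_sdiff
      (((collinearTriples P).filter fun T => id T ⊆ S).image g) S
    have h5 : (((collinearTriples P).filter fun T => id T ⊆ S).image g).card ≤ _ :=
      Finset.card_image_le
    have h6 : S.card ≤ (S \ ((collinearTriples P).filter fun T => id T ⊆ S).image g).card +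
        ((collinearTriples P).filter fun T => id T ⊆ S).card := by omega
    have h7 : (S.card : ℝ) ≤
        ((S \ ((collinearTriples P).filter fun T => id T ⊆ S).image g).card : ℝ) +
        (((collinearTriples P).filter fun T => id T ⊆ S).card : ℝ) := by exact_mod_cast h6
    linarith

/-- The shear `(x, y) ↦ (x + t * y, y)`. -/
def shear (t : ℝ) (q : ℝ × ℝ) : ℝ × ℝ := (q.1 + t * q.2, q.2)

lemma shear_neg_shear (t : ℝ) (q : ℝ × ℝ) : shear (-t) (shear t q) = q := by
  ext <;> simp [shear]

lemma shear_shear_neg (t : ℝ) (q : ℝ × ℝ) : shear t (shear (-t) q) = q := by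
  ext <;> simp [shear]

lemma Collinear.image_shear {T : Finset (ℝ × ℝ)} (h : Collinear ℝ (T : Set (ℝ × ℝ))) (t : ℝ) :
    Collinear ℝ ((T.image (shear t) : Finset (ℝ × ℝ)) : Set (ℝ × ℝ)) := by
  obtain ⟨p, v, h⟩ := (collinear_iff_exists_forall_eq_smul_vadd (k := ℝ) _).1 h
  refine (collinear_iff_exists_forall_eq_smul_vadd (k := ℝ) _).2 ⟨shear t p, shear t v, fun q hq => ?_⟩
  obtain ⟨q, hqT, rfl⟩ := Finset.mem_image.1 (Finset.mem_coe.1 hq)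
  obtain ⟨r, rfl⟩ := h q hqT
  refine ⟨r, ?_⟩
  ext <;> simp [shear]
  ring

lemma card_image_shear (T : Finset (ℝ × ℝ)) (t : ℝ) : (T.image (shear t)).card = T.card :=
  Finset.card_image_of_injective _ (Function.LeftInverse.injective (shear_neg_shear t))

lemma image_shear_neg_subset {S T : Finset (ℝ × ℝ)} {t : ℝ} (h : S ⊆ T.image (shear t)) :
    S.image (shear (-t)) ⊆ T := by
  intro q hq
  obtain ⟨r, hr, rfl⟩ := Finset.mem_image.1 hq
  obtain ⟨s, hs, rfl⟩ := Finset.mem_image.1 (h hr)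
  rwa [shear_neg_shear]

lemma AtMostCollinear.image_shear {P : Finset (ℝ × ℝ)} {l : ℕ} (h : AtMostCollinear P l) (t : ℝ) :
    AtMostCollinear (P.image (shear t)) l := by
  intro T hT hc
  rw [← card_image_shear T (-t)]
  exact h _ (image_shear_neg_subset hT) (hc.image_shear (-t))

lemma exists_injOn_fst_image_shear (P : Finset (ℝ × ℝ)) :
    ∃ t, Set.InjOn Prod.fst ((P.image (shear t) : Finset (ℝ × ℝ)) : Set (ℝ × ℝ)) := by
  obtain ⟨t, ht⟩ := Infinite.exists_notMem_finset
    ((P ×ˢ P).image fun x => -(x.1.1 - x.2.1) / (x.1.2 - x.2.2))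
  refine ⟨t, fun a ha b hb hab => ?_⟩
  obtain ⟨p, hp, rfl⟩ := Finset.mem_image.1 (Finset.mem_coe.1 ha)
  obtain ⟨q, hq, rfl⟩ := Finset.mem_image.1 (Finset.mem_coe.1 hb)
  simp only [shear] at hab
  by_cases h : p.2 = q.2
  · rw [h] at hab
    rw [Prod.ext (by linarith) h]
  · refine absurd (Finset.mem_image.2 ⟨(p, q), Finset.mem_product.2 ⟨hp, hq⟩, ?_⟩) ht
    rw [div_eq_iff (sub_ne_zero.2 h)]
    linarith

theorem exists_generalPosition_of_injOn {d : ℝ} (hd : 0 < d) {l : ℕ} {P : Finset (ℝ × ℝ)}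
    (hl : 3 ≤ l) (hld : (l : ℝ) ≤ d * √(P.card : ℝ)) (hP : AtMostCollinear P l)
    (hinj : Set.InjOn Prod.fst (P : Set (ℝ × ℝ))) :
    ∃ S ⊆ P, GeneralPosition S ∧
      (2 * √(2 * (3 * d ^ 2 + 72)))⁻¹ * √((P.card : ℝ) / Real.log l) ≤ S.card := by
  set n : ℝ := (P.card : ℝ) with hn
  set C : ℝ := 3 * d ^ 2 + 72 with hC
  set g : ℝ := Real.log l with hg
  have hl3 : (3 : ℝ) ≤ l := by exact_mod_cast hl
  have hg1 : 1 ≤ g := by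
    rw [hg, Real.le_log_iff_exp_le (by linarith)]
    exact (Real.exp_one_lt_d9.le.trans (by norm_num)).trans hl3
  have hC1 : 1 ≤ C := by nlinarith
  have hn1 : 1 ≤ n := by
    have : P.card ≠ 0 := by
      intro h
      rw [hn, h] at hld
      simp at hld
      linarith
    rw [hn]
    exact_mod_cast Nat.one_le_iff_ne_zero.2 this
  have hl2 : (l : ℝ) ^ 2 ≤ d ^ 2 * n := by
    have := pow_le_pow_left₀ (by positivity) hld 2
    rwa [mul_pow, Real.sq_sqrt (by linarith)] at this
  have hT : ((collinearTriples P).card : ℝ) ≤ C * n ^ 2 * g := by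
    refine (card_collinearTriples_le hinj hP).trans ?_
    have h1 : 3 * n * (l : ℝ) ^ 2 ≤ 3 * d ^ 2 * n ^ 2 * g := by
      have h2 : 3 * n * (l : ℝ) ^ 2 ≤ 3 * n * (d ^ 2 * n) := by gcongr
      have h3 : 3 * d ^ 2 * n ^ 2 * 1 ≤ 3 * d ^ 2 * n ^ 2 * g := by gcongr
      linarith
    have h4 : 36 * n ^ 2 * (1 + g) ≤ 36 * n ^ 2 * (g + g) := by gcongr
    rw [hC]
    linarith
  have hpos : 0 < 2 * C * (n * g) := by positivity
  set p : ℝ := (√(2 * C * (n * g)))⁻¹ with hp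
  have hp0 : 0 ≤ p := by positivity
  have hng : 1 ≤ n * g := one_le_mul_of_one_le_of_one_le hn1 hg1
  have hp1 : p ≤ 1 := by
    refine inv_le_one_of_one_le₀ (Real.one_le_sqrt.2 ?_)
    nlinarith
  have hp2 : p ^ 2 = (2 * C * (n * g))⁻¹ := by
    rw [hp, inv_pow, Real.sq_sqrt hpos.le]
  obtain ⟨S, hSP, hS, hle⟩ := exists_generalPosition_of_card_collinearTriples P hp0 hp1
  refine ⟨S, hSP, hS, le_trans ?_ hle⟩
  have h5 : p ^ 3 * ((collinearTriples P).card : ℝ) ≤ p * n / 2 := by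
    calc p ^ 3 * ((collinearTriples P).card : ℝ) ≤ p ^ 3 * (C * n ^ 2 * g) := by gcongr
      _ = p * p ^ 2 * (C * n ^ 2 * g) := by ring
      _ = p * n / 2 := by rw [hp2]; field_simp
  have h6 : (2 * √(2 * C))⁻¹ * √(n / g) = p * n / 2 := by
    have hn' : √n * √n = n := Real.mul_self_sqrt (by linarith)
    have hsn : 0 < √n := Real.sqrt_pos.2 (by linarith)
    have hsg : 0 < √g := Real.sqrt_pos.2 (by linarith)
    have hsC : 0 < √(2 * C) := Real.sqrt_pos.2 (by linarith)
    rw [hp, Real.sqrt_mul (by linarith : 0 ≤ 2 * C), Real.sqrt_mul (by linarith : 0 ≤ n),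
      Real.sqrt_div (by linarith)]
    nth_rewrite 3 [← hn']
    field_simp
  rw [h6]
  linarith

/-- For every `d > 0` there is `c > 0` such that every set of `n` points in the plane
with at most `ℓ` collinear, where `3 ≤ ℓ ≤ d·√n`, contains at least `c·√(n / log ℓ)`
points in general position. -/
theorem general_position_subset_sqrt_n_over_log_l :
    ∀ d : ℝ, 0 < d →
    ∃ c : ℝ, 0 < c ∧
      ∀ (n ℓ : ℕ) (P : Finset (ℝ × ℝ)),
        3 ≤ ℓ → (ℓ : ℝ) ≤ d * Real.sqrt n → P.card = n → AtMostCollinear P ℓ →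
        ∃ S ⊆ P, GeneralPosition S ∧
          c * Real.sqrt ((n : ℝ) / Real.log ℓ) ≤ S.card := by
  intro d hd
  refine ⟨(2 * √(2 * (3 * d ^ 2 + 72)))⁻¹, by positivity, ?_⟩
  rintro n l P hl hld rfl hP
  obtain ⟨t, ht⟩ := exists_injOn_fst_image_shear P
  obtain ⟨S, hSP, hS, hle⟩ := exists_generalPosition_of_injOn hd hl
    (by rwa [card_image_shear]) (hP.image_shear t) ht
  rw [card_image_shear] at hle
  refine ⟨S.image (shear (-t)), image_shear_neg_subset hSP, fun T hT hc => ?_,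
    by rwa [card_image_shear]⟩
  rw [← card_image_shear T t]
  refine hS _ (fun q hq => ?_) (hc.image_shear t)
  obtain ⟨r, hr, rfl⟩ := Finset.mem_image.1 hq
  obtain ⟨s, hs, rfl⟩ := Finset.mem_image.1 (hT hr)
  rwa [shear_shear_neg]
end
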